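/- arXiv:1301.6425 — 6 statements merged into one kernel-verified Lean document; each statement's English description precedes it below -/
import Mathlib

section
/- For every complex number z in the cut plane ℂ ∖ (-∞, 0], one has z/((1+z)·Log(1+z)) = ∫₁^∞ t/((t-1)·((ln(t-1))² + π²)) · 1/(z+t) dt, where Log denotes the principal branch of the complex logarithm and the integral is over t ∈ (1, ∞). -/
open MeasureTheory Real Complex

open Filter Topology in
lemma aux_log (k a : ℂ) (hk : k ∈ slitPlane) :
    Tendsto (fun R : ℝ => Complex.log (k * ((R : ℂ) + a)) - (Real.log R : ℂ)) atTop
      (𝓝 (Complex.log k)) := by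
  have h0 : Tendsto (fun R : ℝ => (R : ℂ)⁻¹) atTop (𝓝 0) := by
    have := (Complex.continuous_ofReal.tendsto 0).comp (tendsto_inv_atTop_zero (𝕜 := ℝ))
    simpa [Function.comp_def] using this
  have h1 : Tendsto (fun R : ℝ => k * (1 + a * (R : ℂ)⁻¹)) atTop (𝓝 k) := by
    simpa using ((h0.const_mul a).const_add 1).const_mul k
  have h2 : Tendsto (fun R : ℝ => Complex.log (k * (1 + a * (R : ℂ)⁻¹))) atTop
      (𝓝 (Complex.log k)) := h1.clog hk
  have h3 : ∀ᶠ R : ℝ in atTop, k * (1 + a * (R : ℂ)⁻¹) ≠ 0 :=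
    h1.eventually_ne (slitPlane_ne_zero hk)
  refine h2.congr' ?_
  filter_upwards [h3, eventually_gt_atTop 0] with R hR hpos
  have hRc : (R : ℂ) ≠ 0 := by exact_mod_cast hpos.ne'
  have : k * ((R : ℂ) + a) = (R : ℂ) * (k * (1 + a * (R : ℂ)⁻¹)) := by
    field_simp
  rw [this, Complex.log_ofReal_mul hpos hR]
  ring

open Filter Topology in
lemma aux_int (L : ℂ) (h1 : -π < L.im) (h2 : L.im < π) :
    Tendsto (fun R : ℝ => ∫ x in (-R)..R,
      (((x : ℂ) + (-π * I - L))⁻¹ - ((x : ℂ) + (π * I - L))⁻¹)) atTop (𝓝 (2 * π * I)) := by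
  have hre1 : ∀ x : ℝ, 0 < (I * ((x : ℂ) + (-π * I - L))).re := by
    intro x; simp; linarith
  have hre2 : ∀ x : ℝ, 0 < (-I * ((x : ℂ) + (π * I - L))).re := by
    intro x; simp; linarith
  have hne1 : ∀ x : ℝ, (x : ℂ) + (-π * I - L) ≠ 0 := by
    intro x h; have := hre1 x; rw [h] at this; simp at this
  have hne2 : ∀ x : ℝ, (x : ℂ) + (π * I - L) ≠ 0 := by
    intro x h; have := hre2 x; rw [h] at this; simp at this
  have hd : ∀ x : ℝ, HasDerivAt (fun x : ℝ => Complex.log (I * ((x : ℂ) + (-π * I - L)))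
      - Complex.log (-I * ((x : ℂ) + (π * I - L))))
      (((x : ℂ) + (-π * I - L))⁻¹ - ((x : ℂ) + (π * I - L))⁻¹) x := by
    intro x
    have hid : HasDerivAt (fun x : ℝ => (x : ℂ)) 1 x := Complex.ofRealCLM.hasDerivAt
    have e1 := ((hid.add_const (-π * I - L)).const_mul I).clog_real (Or.inl (hre1 x))
    have e2 := ((hid.add_const (π * I - L)).const_mul (-I)).clog_real (Or.inl (hre2 x))
    rw [mul_div_mul_left _ _ I_ne_zero, one_div] at e1
    rw [mul_div_mul_left _ _ (neg_ne_zero.2 I_ne_zero), one_div] at e2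
    exact e1.sub e2
  have hc : Continuous (fun x : ℝ =>
      (((x : ℂ) + (-π * I - L))⁻¹ - ((x : ℂ) + (π * I - L))⁻¹)) := by
    refine Continuous.sub (Continuous.inv₀ (by fun_prop) hne1) (Continuous.inv₀ (by fun_prop) hne2)
  have hI : ∀ R : ℝ, ∫ x in (-R)..R,
      (((x : ℂ) + (-π * I - L))⁻¹ - ((x : ℂ) + (π * I - L))⁻¹) = _ := fun R =>
    intervalIntegral.integral_eq_sub_of_hasDerivAt (fun x _ => hd x) (hc.intervalIntegrable _ _)
  simp_rw [hI]
  have s1 : I ∈ slitPlane := by simp [mem_slitPlane_iff]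
  have s2 : -I ∈ slitPlane := by simp [mem_slitPlane_iff]
  have t1 := aux_log I (-π * I - L) s1
  have t2 := aux_log (-I) (π * I - L) s2
  have t3 := aux_log (-I) (-(-π * I - L)) s2
  have t4 := aux_log I (-(π * I - L)) s1
  have := (t1.sub t2).sub (t3.sub t4)
  rw [Complex.log_I, Complex.log_neg_I] at this
  have e : (π / 2 * I - -(π / 2) * I - (-(π / 2) * I - π / 2 * I) : ℂ) = 2 * π * I := by ring
  rw [e] at this
  refine this.congr ?_
  intro R
  have e1 : I * (((-R : ℝ) : ℂ) + (-π * I - L)) = -I * ((R : ℂ) + -(-π * I - L)) := by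
    push_cast; ring
  have e2 : -I * (((-R : ℝ) : ℂ) + (π * I - L)) = I * ((R : ℂ) + -(π * I - L)) := by
    push_cast; ring
  rw [e1, e2]
  ring

lemma aux_exp_inj {v L : ℂ} (h1 : -π < L.im) (h2 : L.im < π) (h3 : -π ≤ v.im) (h4 : v.im ≤ π)
    (h : cexp v = cexp L) : v = L := by
  obtain ⟨n, hn⟩ := Complex.exp_eq_exp_iff_exists_int.1 h
  have him := congrArg Complex.im hn
  simp at him
  have hn1 : (n : ℝ) < 1 := by
    by_contra! hc
    nlinarith [Real.pi_pos]
  have hn2 : (-1 : ℝ) < n := by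
    by_contra! hc
    nlinarith [Real.pi_pos]
  have a1 : n < 1 := by exact_mod_cast hn1
  have a2 : -1 < n := by exact_mod_cast hn2
  have : n = 0 := by omega
  simpa [this] using hn

open Filter Topology in
lemma aux_g (L : ℂ) (hL : L ≠ 0) (h1 : -π < L.im) (h2 : L.im < π) :
    ∃ g : ℂ → ℂ, DifferentiableOn ℂ g {v | -π ≤ v.im ∧ v.im ≤ π} ∧
      ∀ v : ℂ, -π ≤ v.im → v.im ≤ π → v ≠ 0 → v ≠ L →
        g v = (cexp v - 1) / (cexp v - cexp L) * v⁻¹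
          - (cexp L - 1) / (cexp L * L) * (v - L)⁻¹ := by
  have hE : ∀ c, DifferentiableOn ℂ (dslope cexp c) Set.univ := fun c =>
    (Complex.differentiableOn_dslope univ_mem).2 Complex.differentiable_exp.differentiableOn
  have hnz : ∀ v : ℂ, -π ≤ v.im → v.im ≤ π → dslope cexp L v ≠ 0 := by
    intro v h3 h4
    by_cases hv : v = L
    · subst hv; simp [dslope_same]
    · rw [dslope_of_ne _ hv, slope_def_field]
      have := fun h => hv (aux_exp_inj h1 h2 h3 h4 h)
      exact div_ne_zero (sub_ne_zero.2 this) (sub_ne_zero.2 hv)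
  set H : ℂ → ℂ := fun v => dslope cexp 0 v / dslope cexp L v with hH
  have hHd : DifferentiableOn ℂ H {v | -π ≤ v.im ∧ v.im ≤ π} :=
    ((hE 0).mono (Set.subset_univ _)).div ((hE L).mono (Set.subset_univ _))
      (fun v hv => hnz v hv.1 hv.2)
  have hnb : {v : ℂ | -π ≤ v.im ∧ v.im ≤ π} ∈ 𝓝 L := by
    have a1 := (Complex.continuous_im.tendsto L).eventually (lt_mem_nhds h1)
    have a2 := (Complex.continuous_im.tendsto L).eventually (gt_mem_nhds h2)
    filter_upwards [a1, a2] with v b1 b2 using ⟨b1.le, b2.le⟩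
  refine ⟨dslope H L, (Complex.differentiableOn_dslope hnb).2 hHd, ?_⟩
  intro v h3 h4 hv0 hvL
  have hne : cexp v - cexp L ≠ 0 := sub_ne_zero.2 fun h => hvL (aux_exp_inj h1 h2 h3 h4 h)
  have hvL' := sub_ne_zero.2 hvL
  have hexp := Complex.exp_ne_zero L
  have A1 : H v = ((cexp v - 1) / v) / ((cexp v - cexp L) / (v - L)) := by
    simp only [hH, dslope_of_ne _ hv0, dslope_of_ne _ hvL, slope_def_field]
    simp
  have A2 : H L = ((cexp L - 1) / L) / cexp L := by
    simp only [hH, dslope_of_ne _ hL, dslope_same, slope_def_field]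
    simp
  rw [dslope_of_ne _ hvL, slope_def_field, A1, A2]
  field_simp

open Filter Topology in
lemma aux_cobdd (a b : ℂ) :
    Tendsto (fun e : ℂ => (e + a) / (e + b)) (Bornology.cobounded ℂ) (𝓝 1) := by
  have h0 : Tendsto (fun e : ℂ => e⁻¹) (Bornology.cobounded ℂ) (𝓝 0) := tendsto_inv₀_cobounded
  have : Tendsto (fun e : ℂ => (1 + a * e⁻¹) / (1 + b * e⁻¹)) (Bornology.cobounded ℂ) (𝓝 1) := by
    have := ((h0.const_mul a).const_add 1).div ((h0.const_mul b).const_add 1) (by simp)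
    simpa [Pi.div_def] using this
  refine this.congr' ?_
  filter_upwards [Bornology.eventually_ne_cobounded (0 : ℂ)] with e he
  have e1 : e + a = e * (1 + a * e⁻¹) := by field_simp
  have e2 : e + b = e * (1 + b * e⁻¹) := by field_simp
  rw [e1, e2, mul_div_mul_left _ _ he]

open Filter Topology in
lemma aux_zero (a b : ℂ) (hb : b ≠ 0) :
    Tendsto (fun e : ℂ => (e + a) / (e + b)) (𝓝 0) (𝓝 (a / b)) := by
  have : ContinuousAt (fun e : ℂ => (e + a) / (e + b)) 0 :=
    ContinuousAt.div (by fun_prop) (by fun_prop) (by simpa)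
  simpa [ContinuousAt] using this

open Filter Topology in
lemma aux_inv (l : Filter ℂ) (hl : Tendsto (fun v : ℂ => |v.re|) l atTop) (a : ℂ) :
    Tendsto (fun v : ℂ => (v - a)⁻¹) l (𝓝 0) := by
  refine tendsto_inv₀_cobounded.comp ?_
  rw [← tendsto_norm_atTop_iff_cobounded]
  refine tendsto_atTop_mono (f := fun v : ℂ => |v.re| - ‖a‖) ?_ (tendsto_atTop_add_const_right _ _ hl)
  intro v
  have := norm_sub_norm_le v a
  have := Complex.abs_re_le_norm v
  linarith

open Filter Topology in
lemma aux_side (w c L : ℂ) (l : Filter ℂ) (m : ℂ)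
    (hl : Tendsto (fun v : ℂ => |v.re|) l atTop)
    (hm : Tendsto (fun v : ℂ => (cexp v - 1) / (cexp v - w)) l (𝓝 m)) :
    Tendsto (fun v : ℂ => (cexp v - 1) / (cexp v - w) * v⁻¹ - c * (v - L)⁻¹) l (𝓝 0) := by
  have h1 := aux_inv l hl 0
  simp only [sub_zero] at h1
  simpa using (hm.mul h1).sub ((aux_inv l hl L).const_mul c)

open Filter Topology in
lemma aux_sideint (g G : ℂ → ℂ) (L : ℂ)
    (hg : ∀ v : ℂ, -π ≤ v.im → v.im ≤ π → v ≠ 0 → v ≠ L → g v = G v)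
    (l : Filter ℝ) (hl : Tendsto (fun x : ℝ => |x|) l atTop)
    (hG : Tendsto G (comap Complex.re l) (𝓝 0)) :
    Tendsto (fun R : ℝ => I • ∫ y in (-π)..π, g ((R : ℂ) + y * I)) l (𝓝 0) := by
  rw [NormedAddGroup.tendsto_nhds_zero]
  intro ε hε
  have hε' : 0 < ε / (4 * π) := by positivity
  have h1 := (NormedAddGroup.tendsto_nhds_zero.1 hG) _ hε'
  rw [eventually_comap] at h1
  filter_upwards [h1, hl.eventually_gt_atTop (‖L‖)] with R hR hRL
  have hR0 : 0 < |R| := (norm_nonneg L).trans_lt hRL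
  have : ‖∫ y in (-π)..π, g ((R : ℂ) + y * I)‖ ≤ ε / (4 * π) * |π - -π| := by
    apply intervalIntegral.norm_integral_le_of_norm_le_const
    intro y hy
    rw [Set.uIoc_of_le (by linarith [Real.pi_pos])] at hy
    have hre : ((R : ℂ) + y * I).re = R := by simp
    have him : ((R : ℂ) + y * I).im = y := by simp
    rw [hg _ (by rw [him]; exact hy.1.le) (by rw [him]; exact hy.2)]
    · exact (hR _ hre).le
    · intro h; rw [h] at hre; simp at hre; simp [← hre] at hR0
    · intro h; rw [h] at hre
      have := Complex.abs_re_le_norm L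
      rw [hre] at this; linarith
  rw [norm_smul, Complex.norm_I, one_mul]
  refine this.trans_lt ?_
  have hp := Real.pi_pos
  rw [abs_of_pos (by linarith)]
  field_simp
  linarith

open Filter Topology in
lemma aux_K_int (w : ℂ) (hw : w ∈ slitPlane) :
    Integrable (fun x : ℝ => (cexp x + 1) / (cexp x + w) * (((x ^ 2 + π ^ 2)⁻¹ : ℝ) : ℂ)) := by
  have hp := Real.pi_gt_three
  have hne : ∀ x : ℝ, cexp x + w ≠ 0 := by
    intro x h
    have hx : w = -((Real.exp x : ℝ) : ℂ) := by push_cast; linear_combination h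
    rw [hx, mem_slitPlane_iff] at hw
    rw [← Complex.ofReal_neg] at hw
    simp only [Complex.ofReal_re, Complex.ofReal_im] at hw
    have := Real.exp_pos x
    rcases hw with h | h
    · linarith
    · exact h rfl
  have hw0 := slitPlane_ne_zero hw
  have hqi : ∀ x : ℝ, x ^ 2 + π ^ 2 ≠ 0 := fun x => by nlinarith [sq_nonneg x]
  have hpr : Integrable (fun x : ℝ => (x ^ 2 + π ^ 2)⁻¹) := by
    refine integrable_inv_one_add_sq.mono' ?_ (ae_of_all _ fun x => ?_)
    · exact (Continuous.inv₀ (by fun_prop) hqi).aestronglyMeasurable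
    · rw [Real.norm_of_nonneg (inv_nonneg.2 (add_nonneg (sq_nonneg _) (sq_nonneg _)))]
      apply inv_anti₀ (by positivity)
      nlinarith
  have hpi : Integrable (fun x : ℝ => (((x ^ 2 + π ^ 2)⁻¹ : ℝ) : ℂ)) := hpr.ofReal
  have hcont : Continuous (fun x : ℝ =>
      (cexp x + 1) / (cexp x + w) * (((x ^ 2 + π ^ 2)⁻¹ : ℝ) : ℂ)) := by
    refine Continuous.mul (Continuous.div (by fun_prop) (by fun_prop) hne) ?_
    exact Complex.continuous_ofReal.comp (Continuous.inv₀ (by fun_prop) hqi)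
  have r1 : Tendsto (fun x : ℝ => (x : ℂ)) atTop (comap Complex.re atTop) := by
    rw [tendsto_comap_iff]; exact tendsto_id
  have r2 : Tendsto (fun x : ℝ => (x : ℂ)) atBot (comap Complex.re atBot) := by
    rw [tendsto_comap_iff]; exact tendsto_id
  have q1 := ((aux_cobdd 1 w).comp (Complex.tendsto_exp_comap_re_atTop.comp r1)).isBigO_one ℂ
  have q2 := ((aux_zero 1 w hw0).comp (Complex.tendsto_exp_comap_re_atBot.comp r2)).isBigO_one ℂ
  refine hcont.locallyIntegrable.integrable_of_isBigO_atBot_atTop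
    (g := fun x : ℝ => (((x ^ 2 + π ^ 2)⁻¹ : ℝ) : ℂ)) (g' := fun x : ℝ => (((x ^ 2 + π ^ 2)⁻¹ : ℝ) : ℂ))
    ?_ (hpi.integrableAtFilter _) ?_ (hpi.integrableAtFilter _)
  · have := q2.mul (Asymptotics.isBigO_refl (fun x : ℝ => (((x ^ 2 + π ^ 2)⁻¹ : ℝ) : ℂ)) atBot)
    simp only [one_mul] at this
    exact this
  · have := q1.mul (Asymptotics.isBigO_refl (fun x : ℝ => (((x ^ 2 + π ^ 2)⁻¹ : ℝ) : ℂ)) atTop)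
    simp only [one_mul] at this
    exact this

open Filter Topology in
lemma aux_K (w : ℂ) (hw : w ∈ slitPlane) (hw1 : w ≠ 1) :
    ∫ x : ℝ, (cexp x + 1) / (cexp x + w) * (((x ^ 2 + π ^ 2)⁻¹ : ℝ) : ℂ) =
      (w - 1) / (w * Complex.log w) := by
  have hpi := Real.pi_pos
  have hw0 := slitPlane_ne_zero hw
  set L := Complex.log w with hLdef
  have hexpL : cexp L = w := Complex.exp_log hw0
  have hL0 : L ≠ 0 := by
    intro h; rw [h, Complex.exp_zero] at hexpL; exact hw1 hexpL.symm
  have h1 : -π < L.im := by rw [hLdef, Complex.log_im]; exact Complex.neg_pi_lt_arg w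
  have h2 : L.im < π := by
    rw [hLdef, Complex.log_im]
    exact lt_of_le_of_ne (Complex.arg_le_pi w) (mem_slitPlane_iff_arg.1 hw).1
  obtain ⟨g, hgd, hg⟩ := aux_g L hL0 h1 h2
  rw [hexpL] at hg
  set c : ℂ := (w - 1) / (w * L) with hc
  have ht1 : Tendsto (fun x : ℝ => |x|) atTop atTop := tendsto_abs_atTop_atTop
  have ht2 : Tendsto (fun x : ℝ => |x|) atBot atTop := tendsto_abs_atBot_atTop
  have m1 : Tendsto (fun v : ℂ => (cexp v - 1) / (cexp v - w)) (comap Complex.re atTop) (𝓝 1) := by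
    simpa [Function.comp_def, sub_eq_add_neg] using
      (aux_cobdd (-1) (-w)).comp Complex.tendsto_exp_comap_re_atTop
  have m2 : Tendsto (fun v : ℂ => (cexp v - 1) / (cexp v - w)) (comap Complex.re atBot)
      (𝓝 (-1 / -w)) := by
    simpa only [Function.comp_def, sub_eq_add_neg] using
      (aux_zero (-1) (-w) (neg_ne_zero.2 hw0)).comp Complex.tendsto_exp_comap_re_atBot
  have S1 := aux_sideint g _ L hg atTop ht1
    (aux_side w c L _ 1 (ht1.comp tendsto_comap) m1)
  have S2 := (aux_sideint g _ L hg atBot ht2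
    (aux_side w c L _ _ (ht2.comp tendsto_comap) m2)).comp tendsto_neg_atTop_atBot
  have hKi := aux_K_int w hw
  have T1 := intervalIntegral_tendsto_integral hKi tendsto_neg_atTop_atBot tendsto_id
  have T2 := aux_int L h1 h2
  have hne1 : ∀ x : ℝ, (x : ℂ) + (-π * I - L) ≠ 0 := by
    intro x h; have := congrArg Complex.im h; simp at this; linarith
  have hne2 : ∀ x : ℝ, (x : ℂ) + (π * I - L) ≠ 0 := by
    intro x h; have := congrArg Complex.im h; simp at this; linarith
  have hc2 : Continuous (fun x : ℝ =>
      (((x : ℂ) + (-π * I - L))⁻¹ - ((x : ℂ) + (π * I - L))⁻¹)) := by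
    refine Continuous.sub (Continuous.inv₀ (by fun_prop) hne1) (Continuous.inv₀ (by fun_prop) hne2)
  have hstrip : ∀ y : ℝ, -π ≤ y → y ≤ π → Continuous (fun x : ℝ => g ((x : ℂ) + y * I)) := by
    intro y hy1 hy2
    refine hgd.continuousOn.comp_continuous (by fun_prop) ?_
    intro x; simpa using ⟨hy1, hy2⟩
  have key : ∀ x : ℝ, g ((x : ℂ) + ((-π : ℝ) : ℂ) * I) - g ((x : ℂ) + (π : ℂ) * I) =
      2 * π * I * ((cexp x + 1) / (cexp x + w) * (((x ^ 2 + π ^ 2)⁻¹ : ℝ) : ℂ))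
      - c * (((x : ℂ) + (-π * I - L))⁻¹ - ((x : ℂ) + (π * I - L))⁻¹) := by
    intro x
    have z1 : (x : ℂ) + ((-π : ℝ) : ℂ) * I ≠ 0 := by
      intro h; have := congrArg Complex.im h; simp at this
    have z2 : (x : ℂ) + (π : ℂ) * I ≠ 0 := by
      intro h; have := congrArg Complex.im h; simp at this
    rw [hg _ (by simp) (by simp; linarith) z1
        (by intro h; have := congrArg Complex.im h; simp at this; linarith),
      hg _ (by simp; linarith) (by simp) z2
        (by intro h; have := congrArg Complex.im h; simp at this; linarith)]
    have x1 : cexp ((x : ℂ) + ((-π : ℝ) : ℂ) * I) = - cexp x := by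
      rw [Complex.exp_add]; push_cast
      rw [neg_mul, Complex.exp_neg, Complex.exp_pi_mul_I]; norm_num
    have x2 : cexp ((x : ℂ) + (π : ℂ) * I) = - cexp x := by
      rw [Complex.exp_add, Complex.exp_pi_mul_I]; ring
    rw [x1, x2]
    have x3 : (-cexp x - 1) / (-cexp x - w) = (cexp x + 1) / (cexp x + w) := by
      rw [← neg_div_neg_eq]; ring_nf
    have x4 : ((x : ℂ) + ((-π : ℝ) : ℂ) * I)⁻¹ - ((x : ℂ) + (π : ℂ) * I)⁻¹
        = 2 * π * I * (((x ^ 2 + π ^ 2)⁻¹ : ℝ) : ℂ) := by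
      have : (((x ^ 2 + π ^ 2)⁻¹ : ℝ) : ℂ)
          = (((x : ℂ) + ((-π : ℝ) : ℂ) * I) * ((x : ℂ) + (π : ℂ) * I))⁻¹ := by
        push_cast
        congr 1
        linear_combination (π : ℂ) ^ 2 * Complex.I_sq
      rw [this, inv_sub_inv z1 z2, div_eq_mul_inv]
      congr 1
      push_cast
      ring
    have x5 : (x : ℂ) + ((-π : ℝ) : ℂ) * I - L = (x : ℂ) + (-π * I - L) := by push_cast; ring
    have x6 : (x : ℂ) + (π : ℂ) * I - L = (x : ℂ) + (π * I - L) := by ring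
    rw [x3, x5, x6]
    linear_combination ((cexp x + 1) / (cexp x + w)) * x4
  have rect : ∀ R : ℝ, 2 * π * I * (∫ x in (-R)..R,
        (cexp x + 1) / (cexp x + w) * (((x ^ 2 + π ^ 2)⁻¹ : ℝ) : ℂ))
      - c * (∫ x in (-R)..R, (((x : ℂ) + (-π * I - L))⁻¹ - ((x : ℂ) + (π * I - L))⁻¹))
      + (I • ∫ y in (-π)..π, g ((R : ℂ) + y * I))
      - (I • ∫ y in (-π)..π, g (((-R : ℝ) : ℂ) + y * I)) = 0 := by
    intro R
    have := Complex.integral_boundary_rect_eq_zero_of_differentiableOn g ⟨-R, -π⟩ ⟨R, π⟩ (by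
      refine hgd.mono ?_
      intro v hv
      have hv2 := hv.2
      simp only [Set.mem_preimage] at hv2
      rw [Set.uIcc_of_le (by linarith)] at hv2
      exact hv2)
    simp only at this
    rw [← intervalIntegral.integral_sub
      ((hstrip (-π) le_rfl (by linarith)).intervalIntegrable _ _)
      ((hstrip π (by linarith) le_rfl).intervalIntegrable _ _)] at this
    simp_rw [key] at this
    rw [intervalIntegral.integral_sub (hKi.intervalIntegrable.const_mul _)
      ((hc2.intervalIntegrable _ _).const_mul _), intervalIntegral.integral_const_mul,
      intervalIntegral.integral_const_mul] at this
    exact this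
  have lim := (((T1.const_mul (2 * π * I : ℂ)).sub (T2.const_mul c)).add S1).sub S2
  have lim0 := lim.congr (fun R => rect R)
  have fin := tendsto_nhds_unique lim0 tendsto_const_nhds
  have h2pi : (2 * π * I : ℂ) ≠ 0 := Complex.two_pi_I_ne_zero
  apply mul_left_cancel₀ h2pi
  linear_combination fin

/-- For every complex number `z` in the cut plane `ℂ ∖ (-∞, 0]`, one has
`z/((1+z)·Log(1+z)) = ∫₁^∞ t/((t-1)·((ln(t-1))² + π²)) · 1/(z+t) dt`. -/
theorem stmt_0 (z : ℂ) (hz : ¬ (z.re ≤ 0 ∧ z.im = 0)) :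
    z / ((1 + z) * Complex.log (1 + z)) =
      ∫ t in Set.Ioi (1 : ℝ),
        Complex.ofReal (t / ((t - 1) * ((Real.log (t - 1)) ^ 2 + Real.pi ^ 2))) / (z + Complex.ofReal t) := by
  have hw : 1 + z ∈ slitPlane := by
    rw [mem_slitPlane_iff]
    by_cases h : z.im = 0
    · left
      have : ¬ z.re ≤ 0 := fun h' => hz ⟨h', h⟩
      simp; linarith
    · right; simpa using h
  have hw1 : 1 + z ≠ 1 := by
    intro h
    have : z = 0 := by simpa using h
    exact hz (by simp [this])
  have hK := aux_K (1 + z) hw hw1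
  have himg : (fun x : ℝ => 1 + Real.exp x) '' Set.univ = Set.Ioi 1 := by
    ext t
    simp only [Set.image_univ, Set.mem_range, Set.mem_Ioi]
    constructor
    · rintro ⟨x, rfl⟩; linarith [Real.exp_pos x]
    · intro h; exact ⟨Real.log (t - 1), by rw [Real.exp_log (by linarith)]; ring⟩
  rw [← himg, integral_image_eq_integral_abs_deriv_smul (f' := Real.exp) MeasurableSet.univ
    (fun x _ => ((Real.hasDerivAt_exp x).const_add 1).hasDerivWithinAt)
    (fun x _ y _ h => Real.exp_injective (by simpa using h)), Measure.restrict_univ]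
  have e1 : z / ((1 + z) * Complex.log (1 + z)) = (1 + z - 1) / ((1 + z) * Complex.log (1 + z)) := by
    ring
  rw [e1, ← hK]
  refine integral_congr_ae (ae_of_all _ fun x => ?_)
  have hx := Real.exp_pos x
  have hxc : cexp x ≠ 0 := Complex.exp_ne_zero _
  simp only [abs_of_pos hx, add_sub_cancel_left, Real.log_exp, Complex.real_smul]
  push_cast
  have e2 : z + (1 + cexp x) = cexp x + (1 + z) := by ring
  rw [e2]
  field_simp
  try ring
end

section
/- For every integer n ≥ 1, the n-th Bernoulli number of the second kind satisfies bₙ = (-1)^{n+1} · ∫₁^∞ 1/(((ln(t-1))² + π²) · tⁿ) dt. -/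
open MeasureTheory Real

lemma aux_choose_rec (y : ℝ) (n : ℕ) :
    Ring.choose y (n+1) = Ring.choose y n * (y - n) / (n + 1) := by
  rw [Ring.choose_eq_smul, Ring.choose_eq_smul, descPochhammer_succ_right, ← Polynomial.aeval_eq_smeval,  ← Polynomial.aeval_eq_smeval]
  simp [Nat.factorial_succ]
  field_simp

lemma aux_choose_bound (y : ℝ) (h0 : 0 ≤ y) (h1 : y ≤ 1) (n : ℕ) : |Ring.choose y n| ≤ 1 := by
  induction n with
  | zero => simp
  | succ n ih =>
    rw [aux_choose_rec, abs_div, abs_mul, abs_of_pos (by positivity : (0:ℝ) < n + 1),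
      div_le_one (by positivity)]
    have : |y - n| ≤ n + 1 := by
      rw [abs_le]; constructor <;> linarith [(Nat.cast_nonneg n : (0:ℝ) ≤ n)]
    nlinarith [abs_nonneg (y - n), abs_nonneg (Ring.choose y n)]

lemma aux_choose_cont (n : ℕ) : Continuous (fun y : ℝ => Ring.choose y n) := by
  induction n with
  | zero => simpa using continuous_const
  | succ n ih =>
    simp_rw [aux_choose_rec]
    fun_prop

lemma aux_binom (x y : ℝ) (hx : |x| < 1) :
    HasSum (fun n : ℕ => Ring.choose y n * x ^ n) ((1 + x) ^ y) := by
  have h := (Real.one_add_rpow_hasFPowerSeriesOnBall_zero (a := y)).hasSum (y := x)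
    (by simpa [enorm_eq_nnnorm, ← NNReal.coe_lt_coe] using hx)
  simpa [binomialSeries, FormalMultilinearSeries.coeff_ofScalars, mul_comm] using h

lemma aux_int_rpow (s : ℝ) (hs : 0 < s) (hs1 : s ≠ 1) :
    ∫ y in (0:ℝ)..1, s ^ y = (s - 1) / Real.log s := by
  have hl : Real.log s ≠ 0 := by
    simp [Real.log_eq_zero]; refine ⟨hs.ne', hs1, by linarith⟩
  have : ∀ y ∈ Set.uIcc (0:ℝ) 1, HasDerivAt (fun y : ℝ => s ^ y / Real.log s) (s ^ y) y := by
    intro y _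
    have := ((hasDerivAt_id y).const_rpow hs).div_const (Real.log s)
    convert! this using 1
    simp; field_simp
  rw [intervalIntegral.integral_eq_sub_of_hasDerivAt this]
  · simp; ring
  · apply Continuous.intervalIntegrable
    exact Real.continuous_const_rpow hs.ne'

lemma aux_b_eq (b : ℕ → ℝ)
    (hb : ∀ x : ℝ, |x| < 1 →
      HasSum (fun n : ℕ => b n * x ^ n)
        (if x = 0 then 1 else x / Real.log (1 + x))) (n : ℕ) :
    b n = ∫ y in (0:ℝ)..1, Ring.choose y n := by
  set d : ℕ → ℝ := fun n => ∫ y in (0:ℝ)..1, Ring.choose y n with hd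
  have hd' : ∀ x : ℝ, |x| < 1 → HasSum (fun n : ℕ => d n * x ^ n)
        (if x = 0 then 1 else x / Real.log (1 + x)) := by
    intro x hx
    have hx' := abs_lt.1 hx
    have h : HasSum (fun n : ℕ => ∫ y in (0:ℝ)..1, Ring.choose y n * x ^ n)
        (∫ y in (0:ℝ)..1, (1 + x) ^ y) := by
      apply intervalIntegral.hasSum_integral_of_dominated_convergence (fun n _ => |x| ^ n)
      · intro n
        exact ((aux_choose_cont n).mul continuous_const).aestronglyMeasurable
      · intro n
        refine Filter.Eventually.of_forall fun y hy => ?_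
        rw [Set.uIoc_of_le zero_le_one] at hy
        rw [norm_mul, norm_pow, Real.norm_eq_abs, Real.norm_eq_abs]
        have := aux_choose_bound y hy.1.le hy.2 n
        exact mul_le_of_le_one_left (by positivity) this
      · exact Filter.Eventually.of_forall fun y hy =>
          summable_geometric_of_lt_one (abs_nonneg x) hx
      · simp
      · exact Filter.Eventually.of_forall fun y hy => aux_binom x y hx
    simp_rw [intervalIntegral.integral_mul_const] at h
    convert! h using 1
    split_ifs with h0
    · simp [h0]
    · rw [aux_int_rpow _ (by linarith) (by simpa using h0)]; simp
  have key : ∀ c : ℕ → ℝ, (∀ x : ℝ, |x| < 1 → HasSum (fun n : ℕ => c n * x ^ n)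
        (if x = 0 then 1 else x / Real.log (1 + x))) →
      HasFPowerSeriesAt (fun x : ℝ => if x = 0 then 1 else x / Real.log (1 + x))
        (FormalMultilinearSeries.ofScalars ℝ c) 0 := by
    intro c hc
    rw [hasFPowerSeriesAt_iff]
    filter_upwards [Metric.ball_mem_nhds (0:ℝ) one_pos] with x hx
    have := hc x (by simpa using hx)
    simpa [FormalMultilinearSeries.coeff_ofScalars, mul_comm] using this
  have := (key b hb).eq_formalMultilinearSeries (key d hd')
  have h2 := congrArg (fun p => FormalMultilinearSeries.coeff p n) this
  simpa [FormalMultilinearSeries.coeff_ofScalars] using h2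

lemma aux_gamma (y : ℝ) (h0 : 0 < y) (h1 : y < 1) (n : ℕ) :
    Ring.choose y (n+1) = (-1)^n * (Real.sin (π * y) / π) *
      (Real.Gamma (1+y) * Real.Gamma (n+1-y) / (n+1).factorial) := by
  induction n with
  | zero =>
    have h := Real.Gamma_mul_Gamma_one_sub y
    have hs : 0 < Real.sin (π * y) := Real.sin_pos_of_pos_of_lt_pi (by positivity)
      (by nlinarith [Real.pi_pos])
    rw [add_comm 1 y, Real.Gamma_add_one h0.ne']
    simp only [zero_add, Ring.choose_one_right, pow_zero, Nat.cast_zero, Nat.factorial_one, one_mul, mul_assoc, h, Nat.cast_one, div_one]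
    field_simp
    rw [mul_comm π y] at hs
    exact (div_self hs.ne').symm
  | succ n ih =>
    rw [aux_choose_rec, ih]
    have : ((n+1 : ℕ):ℝ) + 1 - y = (n + 1 - y) + 1 := by push_cast; ring
    have hp : (0:ℝ) < n + 1 - y := by linarith [(Nat.cast_nonneg n : (0:ℝ) ≤ n)]
    rw [this, Real.Gamma_add_one hp.ne', Nat.factorial_succ (n+1)]
    push_cast
    field_simp
    ring

lemma aux_sin_int (r : ℝ) (hr : 0 < r) :
    ∫ y in (0:ℝ)..1, r ^ y * Real.sin (π * y) = π * (1 + r) / (Real.log r ^ 2 + π ^ 2) := by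
  have hD : Real.log r ^ 2 + π ^ 2 ≠ 0 := by have := Real.pi_pos; positivity
  have : ∀ y ∈ Set.uIcc (0:ℝ) 1, HasDerivAt (fun y : ℝ => r ^ y *
      (Real.log r * Real.sin (π * y) - π * Real.cos (π * y)) / (Real.log r ^ 2 + π ^ 2))
      (r ^ y * Real.sin (π * y)) y := by
    intro y _
    have h1 := (hasDerivAt_id y).const_rpow hr
    have h2 := ((hasDerivAt_id y).const_mul π)
    have h := (h1.mul ((h2.sin.const_mul (Real.log r)).sub (h2.cos.const_mul π))).div_const
      (Real.log r ^ 2 + π ^ 2)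
    convert! h using 1
    simp; field_simp; ring
  rw [intervalIntegral.integral_eq_sub_of_hasDerivAt this]
  · simp; ring
  · apply Continuous.intervalIntegrable
    exact (Real.continuous_const_rpow hr.ne').mul (by fun_prop)

lemma aux_beta (a c : ℝ) (ha : 0 < a) (hc : 0 < c) :
    IntegrableOn (fun w : ℝ => w ^ (a-1) * (1-w) ^ (c-1)) (Set.Ioo 0 1) ∧
    ∫ w in Set.Ioo (0:ℝ) 1, w ^ (a-1) * (1-w) ^ (c-1) =
      Real.Gamma a * Real.Gamma c / Real.Gamma (a + c) := by
  have hcv := Complex.betaIntegral_convergent (u := a) (v := c) (by simpa) (by simpa)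
  rw [intervalIntegrable_iff_integrableOn_Ioo_of_le zero_le_one] at hcv
  have heq : Set.EqOn (fun w : ℝ => ((w:ℂ) ^ ((a:ℂ)-1) * (1-(w:ℂ)) ^ ((c:ℂ)-1)))
      (fun w : ℝ => ((w ^ (a-1) * (1-w) ^ (c-1) : ℝ) : ℂ)) (Set.Ioo 0 1) := by
    intro w hw
    have h1 : 0 ≤ 1 - w := by linarith [hw.2]
    simp only
    push_cast [Complex.ofReal_cpow hw.1.le, Complex.ofReal_cpow h1]
    rfl
  constructor
  · have := (hcv.congr_fun heq measurableSet_Ioo).re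
    simpa [IntegrableOn] using! this
  · have h := Complex.betaIntegral_eq_Gamma_mul_div (a:ℂ) c (by simpa) (by simpa)
    rw [Complex.betaIntegral, intervalIntegral.integral_of_le zero_le_one, integral_Ioc_eq_integral_Ioo,
      setIntegral_congr_fun measurableSet_Ioo heq, integral_complex_ofReal] at h
    rw [← Complex.ofReal_add] at h
    simp only [Complex.Gamma_ofReal] at h
    exact_mod_cast h

lemma aux_subst (m : ℕ) :
    ∫ t in Set.Ioi (1 : ℝ), 1 / (((Real.log (t - 1)) ^ 2 + Real.pi ^ 2) * t ^ (m+1)) =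
    ∫ w in Set.Ioo (0 : ℝ) 1, w ^ m * ((1 + (1-w)/w) / (Real.log ((1-w)/w) ^ 2 + π ^ 2)) := by
  have him : (fun w : ℝ => w⁻¹) '' Set.Ioo 0 1 = Set.Ioi 1 := by
    ext t
    constructor
    · rintro ⟨w, hw, rfl⟩
      exact (one_lt_inv₀ hw.1).2 hw.2
    · intro ht
      have ht : 1 < t := ht
      exact ⟨t⁻¹, ⟨by positivity, inv_lt_one_of_one_lt₀ ht⟩, by simp⟩
  rw [← him, integral_image_eq_integral_abs_deriv_smul (f' := fun w => -(w^2)⁻¹) measurableSet_Ioo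
    (fun w hw => (hasDerivAt_inv hw.1.ne').hasDerivWithinAt) (inv_injective.injOn)]
  refine setIntegral_congr_fun measurableSet_Ioo fun w hw => ?_
  have hw0 := hw.1
  have hD : Real.log ((1-w)/w) ^ 2 + π ^ 2 ≠ 0 := by have := Real.pi_pos; positivity
  have e : w⁻¹ - 1 = (1-w)/w := by field_simp
  simp only [smul_eq_mul, abs_neg, e]
  rw [abs_of_pos (by positivity)]
  have e2 : 1 + (1-w)/w = 1/w := by field_simp; ring
  rw [e2]
  generalize Real.log ((1-w)/w) ^ 2 + π ^ 2 = D at hD ⊢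
  rw [inv_pow]
  field_simp
  ring

lemma aux_main (m : ℕ) :
    ∫ y in (0:ℝ)..1, Ring.choose y (m+1) = (-1 : ℝ) ^ m *
    ∫ w in Set.Ioo (0 : ℝ) 1, w ^ m * ((1 + (1-w)/w) / (Real.log ((1-w)/w) ^ 2 + π ^ 2)) := by
  set f : ℝ → ℝ → ℝ := fun y w =>
    (Real.sin (π * y) / π) * (w ^ ((m + 1 - y) - 1) * (1-w) ^ ((1 + y) - 1)) with hf
  have hb : ∀ y ∈ Set.Ioo (0:ℝ) 1, Integrable (f y) (volume.restrict (Set.Ioo 0 1)) ∧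
      ∫ w in Set.Ioo (0:ℝ) 1, f y w = (-1)^m * Ring.choose y (m+1) := by
    intro y hy
    obtain ⟨h1, h2⟩ := aux_beta (m + 1 - y) (1 + y)
      (by linarith [hy.2, (Nat.cast_nonneg m : (0:ℝ) ≤ m)]) (by linarith [hy.1])
    refine ⟨h1.const_mul _, ?_⟩
    have e : (m:ℝ) + 1 - y + (1 + y) = ((m+1 : ℕ) : ℝ) + 1 := by push_cast; ring
    rw [integral_const_mul, h2, e, Real.Gamma_nat_eq_factorial, aux_gamma y hy.1 hy.2 m,
      ← mul_assoc, ← mul_assoc, ← pow_add, ← two_mul, pow_mul]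
    simp [mul_comm]
  have hpos : ∀ y ∈ Set.Ioo (0:ℝ) 1, ∀ w ∈ Set.Ioo (0:ℝ) 1, 0 ≤ f y w := by
    intro y hy w hw
    have hs : 0 < Real.sin (π * y) := Real.sin_pos_of_pos_of_lt_pi
      (mul_pos Real.pi_pos hy.1) (by nlinarith [Real.pi_pos, hy.2])
    have := hw.1
    have : 0 < 1 - w := by linarith [hw.2]
    have := Real.pi_pos
    simp only [hf]
    positivity
  have hint : Integrable (Function.uncurry f)
      ((volume.restrict (Set.Ioo (0:ℝ) 1)).prod (volume.restrict (Set.Ioo (0:ℝ) 1))) := by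
    have hm : Measurable (Function.uncurry f) := by
      simp only [hf, Function.uncurry_def]
      fun_prop
    rw [integrable_prod_iff hm.aestronglyMeasurable]
    constructor
    · exact ae_restrict_of_forall_mem measurableSet_Ioo fun y hy => (hb y hy).1
    · have hi : IntegrableOn (fun y : ℝ => (-1)^m * Ring.choose y (m+1)) (Set.Ioo 0 1) :=
        ((continuous_const.mul (aux_choose_cont (m+1))).integrableOn_Icc).mono_set
          Set.Ioo_subset_Icc_self
      refine hi.congr_fun ?_ measurableSet_Ioo
      intro y hy
      simp only [Function.uncurry_apply_pair]
      rw [← (hb y hy).2]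
      refine setIntegral_congr_fun measurableSet_Ioo fun w hw => ?_
      exact (Real.norm_of_nonneg (hpos y hy w hw)).symm
  have hsw := integral_integral_swap hint
  rw [setIntegral_congr_fun measurableSet_Ioo (fun y hy => (hb y hy).2), integral_const_mul] at hsw
  have hin : Set.EqOn (fun w => ∫ y in Set.Ioo (0:ℝ) 1, f y w)
      (fun w => w ^ m * ((1 + (1-w)/w) / (Real.log ((1-w)/w) ^ 2 + π ^ 2))) (Set.Ioo 0 1) := by
    intro w hw
    have hw0 := hw.1
    have hw1 : 0 < 1 - w := by linarith [hw.2]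
    have e : ∀ y, f y w = (w ^ m / π) * (((1-w)/w) ^ y * Real.sin (π * y)) := by
      intro y
      simp only [hf]
      rw [Real.div_rpow hw1.le hw0.le, show (m:ℝ) + 1 - y - 1 = m - y by ring,
        Real.rpow_sub hw0, Real.rpow_natCast, show (1 + y) - 1 = y by ring]
      ring
    simp only [e]
    rw [integral_const_mul, ← integral_Ioc_eq_integral_Ioo,
      ← intervalIntegral.integral_of_le zero_le_one, aux_sin_int _ (by positivity)]
    have := Real.pi_ne_zero
    field_simp
  rw [setIntegral_congr_fun measurableSet_Ioo hin] at hsw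
  rw [← hsw, ← mul_assoc, ← pow_add, ← two_mul, pow_mul,
    intervalIntegral.integral_of_le zero_le_one, integral_Ioc_eq_integral_Ioo]
  simp

/-- For every `n ≥ 1`, the `n`-th Bernoulli number of the second kind (i.e. the `n`-th
Taylor coefficient at `0` of `x ↦ x/ln(1+x)`, extended by the value `1` at `x = 0`)
satisfies `bₙ = (-1)^{n+1} ∫₁^∞ 1/(((ln(t-1))² + π²)·tⁿ) dt`. -/
theorem stmt_3 (b : ℕ → ℝ)
    (hb : ∀ x : ℝ, |x| < 1 →
      HasSum (fun n : ℕ => b n * x ^ n)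
        (if x = 0 then 1 else x / Real.log (1 + x))) :
    ∀ n : ℕ, 1 ≤ n →
      b n = (-1 : ℝ) ^ (n + 1) *
        ∫ t in Set.Ioi (1 : ℝ), 1 / (((Real.log (t - 1)) ^ 2 + Real.pi ^ 2) * t ^ n) := by
  intro n hn
  obtain ⟨m, rfl⟩ : ∃ m, n = m + 1 := ⟨n - 1, by omega⟩
  rw [aux_b_eq b hb, aux_main, aux_subst, pow_succ (-1 : ℝ) (m + 1), pow_succ (-1 : ℝ) m]
  simp
end

section
/- For every complex number z in the cut plane ℂ ∖ (-∞, 0], one has 1/Log(1+z) = 1/z + ∫₁^∞ 1/(((ln(t-1))² + π²)·(z+t)) dt, where Log is the principal branch of the complex logarithm and the integral is over t ∈ (1, ∞). -/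
open MeasureTheory Real Complex

lemma exp_sub_ne (L v : ℂ) (h : |(L - v).im| < 2 * π) (hv : v ≠ L) : 1 - Complex.exp (L - v) ≠ 0 := by
  intro h0
  have h1 : Complex.exp (L - v) = 1 := by linear_combination -h0
  obtain ⟨n, hn⟩ := Complex.exp_eq_one_iff.1 h1
  have him : (L - v).im = n * (2 * π) := by rw [hn]; simp
  rw [him, abs_mul, abs_of_pos Real.two_pi_pos] at h
  have h2 : |(n : ℝ)| < 1 := by
    by_contra hc
    push Not at hc
    nlinarith [Real.two_pi_pos]
  have h3 : n = 0 := by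
    have : |n| < 1 := by exact_mod_cast h2
    exact Int.abs_lt_one_iff.1 this
  rw [h3] at hn
  apply hv
  simp at hn
  linear_combination -hn

lemma exists_h (L : ℂ) (hL : L ≠ 0) (hLim : |L.im| < π) :
    ∃ h : ℂ → ℂ, DifferentiableOn ℂ h {v | |v.im| ≤ π} ∧
      ∀ v, v ≠ 0 → v ≠ L → |v.im| ≤ π →
        1 / (v * (1 - Complex.exp (L - v))) =
          h v + (-(1 / (Complex.exp L - 1))) * (1 / v) + (1 / L) * (1 / (v - L)) := by
  set E : ℂ → ℂ := fun v => 1 - Complex.exp (L - v) with hE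
  set D : ℂ → ℂ := dslope E L with hD
  set S : Set ℂ := {v | |(L - v).im| < 2 * π} with hS
  have hSo : IsOpen S := isOpen_lt (by fun_prop) (by fun_prop)
  have hsub : {v : ℂ | |v.im| ≤ π} ⊆ S := by
    intro v hv
    simp only [hS, Set.mem_ofPred_eq, Complex.sub_im] at *
    have := abs_sub L.im v.im
    linarith
  have hLS : S ∈ nhds L := hSo.mem_nhds (hsub hLim.le)
  have h0S : S ∈ nhds 0 := hSo.mem_nhds (hsub (by simp [Real.pi_pos.le]))
  have hEd : DifferentiableOn ℂ E S := by
    intro v _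
    simp only [hE]
    fun_prop
  have hDd : DifferentiableOn ℂ D S := (Complex.differentiableOn_dslope hLS).2 hEd
  have hEL : E L = 0 := by simp [hE]
  have hDL : D L = 1 := by
    rw [hD, dslope_same]
    have : HasDerivAt E (-(Complex.exp (L - L) * (-1))) L :=
      (((hasDerivAt_id L).const_sub L).cexp).const_sub 1
    rw [this.deriv]; simp
  have hDv : ∀ v, v ≠ L → D v = E v / (v - L) := by
    intro v hv
    rw [hD, dslope_of_ne _ hv, slope_def_field, hEL, sub_zero]
  have hDne : ∀ v ∈ S, D v ≠ 0 := by
    intro v hv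
    by_cases h : v = L
    · rw [h, hDL]; exact one_ne_zero
    · rw [hDv v h]
      exact div_ne_zero (exp_sub_ne L v hv h) (sub_ne_zero.2 h)
  set k : ℂ → ℂ := fun v => (D v)⁻¹ with hk
  have hkd : DifferentiableOn ℂ k S := hDd.inv hDne
  have h1 := (Complex.differentiableOn_dslope hLS).2 hkd
  have h2 := (Complex.differentiableOn_dslope h0S).2 hkd
  refine ⟨fun v => (1 / L) * (dslope k L v - dslope k 0 v),
    ((h1.sub h2).const_mul _).mono hsub, ?_⟩
  intro v hv0 hvL hv
  have hEv : E v ≠ 0 := exp_sub_ne L v (hsub hv) hvL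
  have hE0 : E 0 ≠ 0 := exp_sub_ne L 0 (hsub (by simp [Real.pi_pos.le])) hL.symm
  have hexp : Complex.exp L - 1 ≠ 0 := by
    simp only [hE, sub_zero] at hE0
    intro h; apply hE0; linear_combination -h
  have hvL' := sub_ne_zero.2 hvL
  have e1 : k v = (v - L) / E v := by simp only [hk]; rw [hDv v hvL, inv_div]
  have e2 : k 0 = L / (Complex.exp L - 1) := by
    simp only [hk]; rw [hDv 0 hL.symm]; simp only [hE, sub_zero, zero_sub] at hE0 ⊢
    rw [inv_div]
    field_simp
    ring
  have e3 : k L = 1 := by simp [hk, hDL]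
  simp only [dslope_of_ne _ hvL, dslope_of_ne _ hv0, slope_def_field, e1, e2, e3]
  change 1 / (v * E v) = _
  generalize E v = x at hEv
  field_simp
  ring

lemma jump (c : ℂ) (hc : |c.im| < π) :
    Filter.Tendsto (fun R : ℝ => ∫ u in (-R)..R,
      (1 / ((u : ℂ) + ((-π : ℝ) : ℂ) * I - c) - 1 / ((u : ℂ) + (π : ℂ) * I - c)))
      Filter.atTop (nhds (2 * π * I)) := by
  obtain ⟨hc1, hc2⟩ := abs_lt.1 hc
  set F : ℝ → ℂ := fun u => Complex.log ((u : ℂ) + ((-π : ℝ) : ℂ) * I - c) -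
    Complex.log ((u : ℂ) + (π : ℂ) * I - c) with hF
  have s1 : ∀ u : ℝ, ((u : ℂ) + ((-π : ℝ) : ℂ) * I - c).im < 0 := by
    intro u; simp; linarith
  have s2 : ∀ u : ℝ, 0 < ((u : ℂ) + (π : ℂ) * I - c).im := by
    intro u; simp; linarith
  have n1 : ∀ u : ℝ, ((u : ℂ) + ((-π : ℝ) : ℂ) * I - c) ≠ 0 := by
    intro u h; have := s1 u; rw [h] at this; simp at this
  have n2 : ∀ u : ℝ, ((u : ℂ) + (π : ℂ) * I - c) ≠ 0 := by
    intro u h; have := s2 u; rw [h] at this; simp at this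
  have hder : ∀ u : ℝ, HasDerivAt F (1 / ((u : ℂ) + ((-π : ℝ) : ℂ) * I - c) -
      1 / ((u : ℂ) + (π : ℂ) * I - c)) u := by
    intro u
    have h1 : HasDerivAt (fun u : ℝ => (u : ℂ) + ((-π : ℝ) : ℂ) * I - c) 1 u :=
      ((Complex.ofRealCLM.hasDerivAt).add_const _).sub_const _
    have h2 : HasDerivAt (fun u : ℝ => (u : ℂ) + (π : ℂ) * I - c) 1 u :=
      ((Complex.ofRealCLM.hasDerivAt).add_const _).sub_const _
    exact (h1.clog_real (Complex.mem_slitPlane_iff.2 (Or.inr (s1 u).ne))).sub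
      (h2.clog_real (Complex.mem_slitPlane_iff.2 (Or.inr (s2 u).ne')))
  have hcont : Continuous (fun u : ℝ => 1 / ((u : ℂ) + ((-π : ℝ) : ℂ) * I - c) -
      1 / ((u : ℂ) + (π : ℂ) * I - c)) := by
    refine Continuous.sub (Continuous.div (by fun_prop) (by fun_prop) n1)
      (Continuous.div (by fun_prop) (by fun_prop) n2)
  have hint : ∀ R : ℝ, ∫ u in (-R)..R, (1 / ((u : ℂ) + ((-π : ℝ) : ℂ) * I - c) -
      1 / ((u : ℂ) + (π : ℂ) * I - c)) = F R - F (-R) := fun R =>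
    intervalIntegral.integral_eq_sub_of_hasDerivAt (fun u _ => hder u)
      (hcont.intervalIntegrable _ _)
  simp only [hint]
  have hinv : Filter.Tendsto (fun R : ℝ => ((R⁻¹ : ℝ) : ℂ)) Filter.atTop (nhds 0) := by
    have := (Complex.continuous_ofReal.tendsto 0).comp (tendsto_inv_atTop_zero (𝕜 := ℝ))
    simpa [Function.comp_def] using this
  have key : ∀ (d : ℂ) (e : ℝ), Filter.Tendsto (fun R : ℝ => (e : ℂ) + ((R⁻¹ : ℝ) : ℂ) * d)
      Filter.atTop (nhds e) := by
    intro d e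
    simpa using (hinv.mul_const d).const_add (e : ℂ)
  have lsc : ∀ (d : ℂ) (e R : ℝ), 0 < R → (((e * R : ℝ) : ℂ) + d) ≠ 0 →
      Complex.log (((e * R : ℝ) : ℂ) + d) =
        (Real.log R : ℂ) + Complex.log ((e : ℂ) + ((R⁻¹ : ℝ) : ℂ) * d) := by
    intro d e R hR hne
    have hR' : (R : ℂ) ≠ 0 := by exact_mod_cast hR.ne'
    have : ((e * R : ℝ) : ℂ) + d = (R : ℂ) * ((e : ℂ) + ((R⁻¹ : ℝ) : ℂ) * d) := by
      push_cast; field_simp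
    rw [this] at hne ⊢
    exact Complex.log_ofReal_mul hR (right_ne_zero_of_mul hne)
  set d1 : ℂ := ((-π : ℝ) : ℂ) * I - c with hd1
  set d2 : ℂ := (π : ℂ) * I - c with hd2
  have d1im : d1.im < 0 := by have := s1 0; rw [hd1]; simpa using this
  have d2im : 0 < d2.im := by have := s2 0; rw [hd2]; simpa using this
  have l1 : ∀ d : ℂ, Filter.Tendsto (fun R : ℝ => Complex.log (((1:ℝ) : ℂ) + ((R⁻¹ : ℝ) : ℂ) * d))
      Filter.atTop (nhds 0) := by
    intro d
    have := (key d 1).clog (by simp)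
    simpa using this
  have l2 : Filter.Tendsto (fun R : ℝ => Complex.log (((-1:ℝ) : ℂ) + ((R⁻¹ : ℝ) : ℂ) * d1))
      Filter.atTop (nhds (-π * I)) := by
    have h := Complex.tendsto_log_nhdsWithin_im_neg_of_re_neg_of_im_zero
      (z := ((-1:ℝ) : ℂ)) (by simp) (by simp)
    have h' := h.comp (f := fun R : ℝ => (((-1:ℝ) : ℂ) + ((R⁻¹ : ℝ) : ℂ) * d1))
      (x := Filter.atTop) (tendsto_nhdsWithin_iff.2 ⟨key d1 (-1), by
        filter_upwards [Filter.eventually_gt_atTop 0] with R hR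
        have := mul_neg_of_pos_of_neg (inv_pos.2 hR) d1im
        simpa [-Complex.ofReal_inv] using this⟩)
    simpa [Function.comp_def] using h'
  have l3 : Filter.Tendsto (fun R : ℝ => Complex.log (((-1:ℝ) : ℂ) + ((R⁻¹ : ℝ) : ℂ) * d2))
      Filter.atTop (nhds (π * I)) := by
    have h := Complex.tendsto_log_nhdsWithin_im_nonneg_of_re_neg_of_im_zero
      (z := ((-1:ℝ) : ℂ)) (by simp) (by simp)
    have h' := h.comp (f := fun R : ℝ => (((-1:ℝ) : ℂ) + ((R⁻¹ : ℝ) : ℂ) * d2))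
      (x := Filter.atTop) (tendsto_nhdsWithin_iff.2 ⟨key d2 (-1), by
        filter_upwards [Filter.eventually_gt_atTop 0] with R hR
        have := (mul_pos (inv_pos.2 hR) d2im).le
        simpa [-Complex.ofReal_inv] using this⟩)
    simpa [Function.comp_def] using h'
  have tot := ((l1 d1).sub (l1 d2)).sub (l2.sub l3)
  have ev : (0 : ℂ) - 0 - (-π * I - π * I) = 2 * π * I := by ring
  rw [ev] at tot
  refine tot.congr' ?_
  filter_upwards [Filter.eventually_gt_atTop 0] with R hR
  have a1 := lsc d1 1 R hR (by have := n1 R; rwa [add_sub_assoc, ← hd1, ← one_mul R] at this)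
  have a2 := lsc d2 1 R hR (by have := n2 R; rwa [add_sub_assoc, ← hd2, ← one_mul R] at this)
  have a3 := lsc d1 (-1) R hR (by have := n1 (-R); rwa [add_sub_assoc, ← hd1, ← neg_one_mul R] at this)
  have a4 := lsc d2 (-1) R hR (by have := n2 (-R); rwa [add_sub_assoc, ← hd2, ← neg_one_mul R] at this)
  simp only [hF, add_sub_assoc, ← hd1, ← hd2]
  rw [one_mul] at a1 a2
  rw [neg_one_mul] at a3 a4
  rw [a1, a2, a3, a4]
  ring

/-- decay on vertical sides -/
lemma vert (L : ℂ) (a b : ℂ) (h : ℂ → ℂ)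
    (hh : ∀ v, v ≠ 0 → v ≠ L → |v.im| ≤ π →
        1 / (v * (1 - Complex.exp (L - v))) = h v + a * (1 / v) + b * (1 / (v - L)))
    (e : ℝ) (he : e = 1 ∨ e = -1) :
    Filter.Tendsto (fun R : ℝ => ∫ y in (-π)..π, h (((e * R : ℝ) : ℂ) + (y : ℂ) * I))
      Filter.atTop (nhds 0) := by
  have lim : Filter.Tendsto (fun R : ℝ => ((2 + ‖a‖) * R⁻¹ + ‖b‖ * (R + (-|L.re|))⁻¹) * |π - (-π)|)
      Filter.atTop (nhds 0) := by
    have t1 := tendsto_inv_atTop_zero (𝕜 := ℝ)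
    have t2 := t1.comp (Filter.tendsto_atTop_add_const_right Filter.atTop (-|L.re|) Filter.tendsto_id)
    have := ((t1.const_mul (2 + ‖a‖)).add (t2.const_mul ‖b‖)).mul_const |π - (-π)|
    simpa using this
  refine squeeze_zero_norm' ?_ lim
  filter_upwards [Filter.eventually_gt_atTop (|L.re| + 1)] with R hR
  apply intervalIntegral.norm_integral_le_of_norm_le_const
  intro y hy
  rw [Set.uIoc_of_le (by linarith [Real.pi_pos])] at hy
  have hL0 := abs_nonneg L.re
  have hL1 := neg_abs_le L.re
  have hL2 := le_abs_self L.re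
  set v : ℂ := ((e * R : ℝ) : ℂ) + (y : ℂ) * I with hv
  have vre : v.re = e * R := by simp [hv]
  have vim : v.im = y := by simp [hv]
  have hRv : R ≤ ‖v‖ := by
    refine le_trans ?_ (Complex.abs_re_le_norm v)
    rw [vre]
    rcases he with rfl | rfl <;> rw [abs_mul] <;> simp [le_abs_self]
  have hRL : R + (-|L.re|) ≤ ‖v - L‖ := by
    refine le_trans ?_ (Complex.abs_re_le_norm (v - L))
    rw [Complex.sub_re, vre]
    rcases he with rfl | rfl
    · refine le_trans ?_ (le_abs_self _); linarith
    · refine le_trans ?_ (neg_le_abs _); linarith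
  have v0 : v ≠ 0 := norm_pos_iff.1 (by linarith)
  have vL : v ≠ L := sub_ne_zero.1 (norm_pos_iff.1 (by linarith))
  have hvv := hh v v0 vL (by rw [vim, abs_le]; exact ⟨hy.1.le, hy.2⟩)
  have hE : 1 / 2 ≤ ‖1 - Complex.exp (L - v)‖ := by
    have hn : ‖Complex.exp (L - v)‖ = Real.exp (L.re - e * R) := by
      rw [Complex.norm_exp, Complex.sub_re, vre]
    rcases he with rfl | rfl
    · have h1 : Real.exp (L.re - 1 * R) ≤ 1 / 2 := by
        have h2 : Real.exp (L.re - 1 * R) ≤ Real.exp (-1) := Real.exp_le_exp.2 (by linarith)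
        have h3 : Real.exp (-1) < 1 / 2 := by
          have := Real.exp_neg_one_lt_d9; linarith
        linarith
      have := norm_sub_norm_le (1 : ℂ) (Complex.exp (L - v))
      rw [hn, norm_one] at this; linarith
    · have h1 : 2 ≤ Real.exp (L.re - -1 * R) := by
        have := Real.add_one_le_exp (L.re - -1 * R); linarith
      have := norm_sub_norm_le (Complex.exp (L - v)) (1 : ℂ)
      rw [hn, norm_one, norm_sub_rev] at this; linarith
  have hR0 : 0 < R := by linarith
  have : h v = 1 / (v * (1 - Complex.exp (L - v))) - a * (1 / v) - b * (1 / (v - L)) := by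
    rw [hvv]; ring
  rw [this]
  have i1 : ‖v‖⁻¹ ≤ R⁻¹ := inv_anti₀ hR0 hRv
  have i2 : ‖v - L‖⁻¹ ≤ (R + (-|L.re|))⁻¹ := inv_anti₀ (by linarith) hRL
  have i3 : ‖1 - Complex.exp (L - v)‖⁻¹ ≤ 2 := by
    have := inv_anti₀ (by norm_num) hE; norm_num at this; exact this
  calc _ ≤ ‖1 / (v * (1 - Complex.exp (L - v)))‖ + ‖a * (1 / v)‖ + ‖b * (1 / (v - L))‖ :=
        (norm_sub_le _ _).trans (add_le_add_left (norm_sub_le _ _) _)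
    _ = ‖1 - Complex.exp (L - v)‖⁻¹ * ‖v‖⁻¹ + ‖a‖ * ‖v‖⁻¹ + ‖b‖ * ‖v - L‖⁻¹ := by
        simp [norm_mul, norm_inv]
    _ ≤ 2 * R⁻¹ + ‖a‖ * R⁻¹ + ‖b‖ * (R + (-|L.re|))⁻¹ := by gcongr
    _ = _ := by ring

lemma strip (L : ℂ) (hL : L ≠ 0) (hLim : |L.im| < π)
    (hi : Integrable (fun u : ℝ => 1 / (((u ^ 2 + π ^ 2 : ℝ) : ℂ) * (1 + Complex.exp (L - u))))) :
    ∫ u : ℝ, 1 / (((u ^ 2 + π ^ 2 : ℝ) : ℂ) * (1 + Complex.exp (L - u))) =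
      1 / L - 1 / (Complex.exp L - 1) := by
  obtain ⟨h, hd, hh⟩ := exists_h L hL hLim
  obtain ⟨hL1, hL2⟩ := abs_lt.1 hLim
  set a := -(1 / (Complex.exp L - 1)) with ha
  set b := 1 / L with hb
  have hpi := Real.pi_pos
  have T1 := intervalIntegral_tendsto_integral hi Filter.tendsto_neg_atTop_atBot Filter.tendsto_id
  have J0 := (jump 0 (by simpa using hpi)).const_mul a
  have JL := (jump L hLim).const_mul b
  have V1 := (vert L a b h hh 1 (Or.inl rfl)).const_mul I
  have V2 := (vert L a b h hh (-1) (Or.inr rfl)).const_mul I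
  have T2 := ((J0.add JL).add (V2.sub V1)).const_mul ((2 * π * I)⁻¹)
  have hI : (2 * π * I : ℂ) ≠ 0 := Complex.two_pi_I_ne_zero
  have hval : (2 * π * I : ℂ)⁻¹ * (a * (2 * π * I) + b * (2 * π * I) + (I * 0 - I * 0)) =
      1 / L - 1 / (Complex.exp L - 1) := by
    rw [ha, hb]; field_simp; ring
  rw [hval] at T2
  refine tendsto_nhds_unique T1 (T2.congr' ?_)
  filter_upwards [Filter.eventually_gt_atTop 0] with R hR
  -- continuity on lines
  have cl : ∀ s : ℝ, |s| ≤ π → Continuous (fun u : ℝ => h ((u : ℂ) + (s : ℂ) * I)) := by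
    intro s hs
    exact hd.continuousOn.comp_continuous (by fun_prop) (by intro u; simpa using hs)
  have nn : ∀ (s : ℝ) (c : ℂ), c.im ≠ s → ∀ u : ℝ, (u : ℂ) + (s : ℂ) * I - c ≠ 0 := by
    intro s c hs u h0
    apply hs
    have := congrArg Complex.im h0
    simp at this; linarith
  have cj : ∀ c : ℂ, |c.im| < π → Continuous (fun u : ℝ =>
      (1 / ((u : ℂ) + ((-π : ℝ) : ℂ) * I - c) - 1 / ((u : ℂ) + (π : ℂ) * I - c))) := by
    intro c hc
    obtain ⟨hc1, hc2⟩ := abs_lt.1 hc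
    exact Continuous.sub (Continuous.div (by fun_prop) (by fun_prop) (nn (-π) c hc1.ne'))
      (Continuous.div (by fun_prop) (by fun_prop) (nn π c hc2.ne))
  have rect := Complex.integral_boundary_rect_eq_zero_of_differentiableOn h
    (⟨-R, -π⟩ : ℂ) (⟨R, π⟩ : ℂ) (hd.mono (by
      intro v hv
      have := hv.2
      simp only [Set.mem_preimage] at this
      rw [Set.uIcc_of_le (by linarith)] at this
      exact abs_le.2 this))
  simp only [smul_eq_mul] at rect
  have pt : ∀ u : ℝ, 1 / (((u ^ 2 + π ^ 2 : ℝ) : ℂ) * (1 + Complex.exp (L - u))) =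
      (2 * π * I)⁻¹ * ((h ((u : ℂ) + ((-π : ℝ) : ℂ) * I) - h ((u : ℂ) + (π : ℂ) * I)) +
        (a * (1 / ((u : ℂ) + ((-π : ℝ) : ℂ) * I - 0) - 1 / ((u : ℂ) + (π : ℂ) * I - 0)) +
        b * (1 / ((u : ℂ) + ((-π : ℝ) : ℂ) * I - L) - 1 / ((u : ℂ) + (π : ℂ) * I - L)))) := by
    intro u
    have m0 := nn (-π) 0 (by simpa using hpi.ne) u
    have mL := nn (-π) L hL1.ne' u
    have p0 := nn π 0 (by simpa using hpi.ne) u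
    have pL := nn π L hL2.ne u
    rw [sub_zero] at m0 p0
    have g1 := hh _ m0 (sub_ne_zero.1 mL) (by simp [abs_of_pos hpi])
    have g2 := hh _ p0 (sub_ne_zero.1 pL) (by simp [abs_of_pos hpi])
    have x1 : Complex.exp (L - ((u : ℂ) + ((-π : ℝ) : ℂ) * I)) = - Complex.exp (L - u) := by
      rw [show L - ((u : ℂ) + ((-π : ℝ) : ℂ) * I) = (L - u) + π * I by push_cast; ring,
        Complex.exp_add, Complex.exp_pi_mul_I]; ring
    have x2 : Complex.exp (L - ((u : ℂ) + (π : ℂ) * I)) = - Complex.exp (L - u) := by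
      rw [show L - ((u : ℂ) + (π : ℂ) * I) = (L - u) - π * I by ring,
        Complex.exp_sub, Complex.exp_pi_mul_I]; ring
    rw [x1, sub_neg_eq_add] at g1
    rw [x2, sub_neg_eq_add] at g2
    have hden : (((u ^ 2 + π ^ 2 : ℝ) : ℂ)) =
        ((u : ℂ) + ((-π : ℝ) : ℂ) * I) * ((u : ℂ) + (π : ℂ) * I) := by
      push_cast; linear_combination (π : ℂ)^2 * Complex.I_sq
    have step : 1 / (((u ^ 2 + π ^ 2 : ℝ) : ℂ) * (1 + Complex.exp (L - u))) =
      (2 * π * I)⁻¹ * (1 / (((u : ℂ) + ((-π : ℝ) : ℂ) * I) * (1 + Complex.exp (L - u)))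
        - 1 / (((u : ℂ) + (π : ℂ) * I) * (1 + Complex.exp (L - u)))) := by
      have hdiff : (2 * π * I : ℂ) = ((u : ℂ) + (π : ℂ) * I) - ((u : ℂ) + ((-π : ℝ) : ℂ) * I) := by
        push_cast; ring
      rw [hden]
      rw [hdiff] at hI ⊢
      generalize (u : ℂ) + (π : ℂ) * I = p at *
      generalize (u : ℂ) + ((-π : ℝ) : ℂ) * I = m at *
      generalize (1 + Complex.exp (L - u)) = q at *
      by_cases hq : q = 0
      · simp [hq]
      field_simp
    rw [step, g1, g2, sub_zero, sub_zero]
    ring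
  simp only [pt, id]
  rw [intervalIntegral.integral_const_mul]
  congr 1
  have c1 := cl (-π) (by rw [abs_neg, abs_of_pos hpi])
  have c2 := cl π (by rw [abs_of_pos hpi])
  have c3 := cj 0 (by simpa using hpi)
  have c4 := cj L hLim
  have c12 : Continuous (fun u : ℝ => h ((u : ℂ) + ((-π : ℝ) : ℂ) * I) - h ((u : ℂ) + (π : ℂ) * I)) :=
    c1.sub c2
  have c34 : Continuous (fun u : ℝ =>
      a * (1 / ((u : ℂ) + ((-π : ℝ) : ℂ) * I - 0) - 1 / ((u : ℂ) + (π : ℂ) * I - 0)) +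
        b * (1 / ((u : ℂ) + ((-π : ℝ) : ℂ) * I - L) - 1 / ((u : ℂ) + (π : ℂ) * I - L))) :=
    (c3.const_mul a).add (c4.const_mul b)
  rw [intervalIntegral.integral_add (c12.intervalIntegrable _ _) (c34.intervalIntegrable _ _),
    intervalIntegral.integral_add ((c3.const_mul a).intervalIntegrable _ _)
      ((c4.const_mul b).intervalIntegrable _ _),
    intervalIntegral.integral_const_mul, intervalIntegral.integral_const_mul,
    intervalIntegral.integral_sub (c1.intervalIntegrable _ _) (c2.intervalIntegrable _ _)]
  simp only [one_mul, neg_one_mul]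
  linear_combination -rect

lemma bound_aux (w : ℂ) (hw : 0 ≤ w.re ∨ w.im ≠ 0) :
    ∃ C : ℝ, ∀ s : ℝ, 0 < s → s ≤ C * ‖w + s‖ := by
  rcases hw with h | h
  · refine ⟨1, fun s hs => ?_⟩
    rw [one_mul]
    refine le_trans ?_ (Complex.re_le_norm _)
    simpa using h
  · refine ⟨‖w‖ / |w.im|, fun s hs => ?_⟩
    have h1 := Complex.abs_im_le_norm ((w + s) * (starRingEnd ℂ) w)
    have h2 : ((w + s) * (starRingEnd ℂ) w).im = - (s * w.im) := by
      simp; ring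
    rw [h2, norm_mul, Complex.norm_conj, abs_neg, abs_mul, abs_of_pos hs] at h1
    rw [div_mul_eq_mul_div, le_div_iff₀ (abs_pos.2 h)]
    linarith

lemma integ (L : ℂ) (hn : 0 ≤ (Complex.exp L).re ∨ (Complex.exp L).im ≠ 0) :
    Integrable (fun u : ℝ => 1 / (((u ^ 2 + π ^ 2 : ℝ) : ℂ) * (1 + Complex.exp (L - u)))) := by
  obtain ⟨C, hC⟩ := bound_aux _ hn
  have hpi := Real.pi_pos
  have hb : Integrable (fun u : ℝ => C * (1 + u ^ 2)⁻¹) := integrable_inv_one_add_sq.const_mul C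
  have fac : ∀ u : ℝ, 1 + Complex.exp (L - u) = (Complex.exp L + (Real.exp u : ℂ)) / (Real.exp u : ℂ) := by
    intro u
    rw [Complex.exp_sub, Complex.ofReal_exp]
    field_simp [Complex.exp_ne_zero]
    ring
  refine hb.mono' (Measurable.aestronglyMeasurable (by fun_prop)) (Filter.Eventually.of_forall ?_)
  intro u
  have hs := hC (Real.exp u) (Real.exp_pos u)
  have hep := Real.exp_pos u
  have hpos : 0 < ‖Complex.exp L + (Real.exp u : ℂ)‖ := by
    by_contra hc
    have : ‖Complex.exp L + (Real.exp u : ℂ)‖ = 0 := le_antisymm (not_lt.1 hc) (norm_nonneg _)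
    rw [this] at hs; linarith
  rw [fac, norm_div, norm_one, norm_mul, norm_div, Complex.norm_real, Complex.norm_real,
    Real.norm_of_nonneg hep.le, Real.norm_of_nonneg (by positivity)]
  have hC0 : 0 ≤ C := by
    by_contra hc
    nlinarith
  have hq : (1 + u ^ 2) ≤ u ^ 2 + π ^ 2 := by nlinarith [Real.pi_gt_three]
  have e : 1 / ((u ^ 2 + π ^ 2) * (‖Complex.exp L + (Real.exp u : ℂ)‖ / Real.exp u)) =
      (Real.exp u / ‖Complex.exp L + (Real.exp u : ℂ)‖) * (u ^ 2 + π ^ 2)⁻¹ := by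
    field_simp
  rw [e]
  gcongr
  rwa [div_le_iff₀ hpos]

theorem stmt_13 (z : ℂ) (hz : ¬ (z.re ≤ 0 ∧ z.im = 0)) :
    1 / Complex.log (1 + z) =
      1 / z +
        ∫ t in Set.Ioi (1 : ℝ),
          1 / ((Complex.ofReal ((Real.log (t - 1)) ^ 2 + Real.pi ^ 2)) * (z + Complex.ofReal t)) := by
  have hw0 : 1 + z ≠ 0 := by
    intro h
    apply hz
    have : z = -1 := by linear_combination h
    rw [this]; simp
  have hz0 : z ≠ 0 := by rintro rfl; simp at hz
  have hcase : 0 ≤ (1 + z).re ∨ (1 + z).im ≠ 0 := by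
    by_contra hc
    push Not at hc
    apply hz
    simp at hc
    exact ⟨by linarith [hc.1], hc.2⟩
  set L := Complex.log (1 + z) with hLdef
  have hexp : Complex.exp L = 1 + z := Complex.exp_log hw0
  have hL : L ≠ 0 := by
    intro h
    rw [h, Complex.exp_zero] at hexp
    apply hz0; linear_combination -hexp
  have hLim : |L.im| < π := by
    rw [hLdef, Complex.log_im]
    refine lt_of_le_of_ne (Complex.abs_arg_le_pi _) ?_
    intro h
    have h2 : Complex.arg (1 + z) = π := by
      rcases abs_choice (Complex.arg (1 + z)) with h' | h'
      · rw [← h', h]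
      · have := Complex.neg_pi_lt_arg (1 + z)
        linarith
    rw [Complex.arg_eq_pi_iff] at h2
    rcases hcase with h3 | h3
    · linarith [h2.1]
    · exact h3 h2.2
  have himg : (fun u : ℝ => 1 + Real.exp u) '' Set.univ = Set.Ioi (1 : ℝ) := by
    ext t
    simp only [Set.image_univ, Set.mem_range, Set.mem_Ioi]
    constructor
    · rintro ⟨u, rfl⟩; linarith [Real.exp_pos u]
    · intro ht
      exact ⟨Real.log (t - 1), by rw [Real.exp_log (by linarith)]; ring⟩
  have hcv := MeasureTheory.integral_image_eq_integral_abs_deriv_smul (s := Set.univ)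
    (f := fun u : ℝ => 1 + Real.exp u) (f' := Real.exp) MeasurableSet.univ
    (fun u _ => ((Real.hasDerivAt_exp u).const_add 1).hasDerivWithinAt)
    (by intro x _ y _ hxy; simpa using hxy)
    (fun t : ℝ => 1 / ((Complex.ofReal ((Real.log (t - 1)) ^ 2 + Real.pi ^ 2)) * (z + Complex.ofReal t)))
  rw [himg] at hcv
  rw [hcv, setIntegral_univ]
  have hs := strip L hL hLim (integ L (by rwa [hexp]))
  have hcongr : ∀ u : ℝ, |Real.exp u| • (1 / ((Complex.ofReal ((Real.log (1 + Real.exp u - 1)) ^ 2 + Real.pi ^ 2)) * (z + Complex.ofReal (1 + Real.exp u)))) =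
      1 / (((u ^ 2 + π ^ 2 : ℝ) : ℂ) * (1 + Complex.exp (L - u))) := by
    intro u
    rw [add_sub_cancel_left, Real.log_exp, abs_of_pos (Real.exp_pos u), Complex.exp_sub, hexp,
      Complex.real_smul, ← Complex.ofReal_exp]
    have hne : ((Real.exp u : ℝ) : ℂ) ≠ 0 := by exact_mod_cast (Real.exp_pos u).ne'
    have e : 1 + (1 + z) / ((Real.exp u : ℝ) : ℂ) = (z + Complex.ofReal (1 + Real.exp u)) / ((Real.exp u : ℝ) : ℂ) := by
      field_simp
      push_cast; ring
    rw [e, mul_one_div, ← mul_div_assoc, one_div_div]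
  simp only [hcongr]
  rw [hs, hexp]
  ring
end

section
/- For every integer k ≥ 1 and every real x > 0, the k-th derivative of the function x ↦ x/ln(1+x) satisfies (d/dx)^k [ x/ln(1+x) ] = (-1)^{k+1} · k! · ∫₁^∞ t/(((ln(t-1))² + π²)·(x+t)^{k+1}) dt. -/
open MeasureTheory Real

open Filter Topology

lemma exists_g (a : ℝ) (ha : 0 < a) : ∃ g : ℂ → ℂ,
    DifferentiableOn ℂ g {z | |z.im| < 2 * Real.pi} ∧
    ∀ z : ℂ, |z.im| < 2 * Real.pi → z ≠ 0 → z ≠ a →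
      g z = 1 / (z * (1 - Complex.exp (a - z))) - (1 / a : ℂ) / (z - a)
        + (1 / (Complex.exp a - 1)) / z := by
  set S : Set ℂ := {z | |z.im| < 2 * Real.pi} with hS
  have hSo : IsOpen S := isOpen_lt (by fun_prop) (by fun_prop)
  have h0S : (0 : ℂ) ∈ S := by simp [hS, Real.pi_pos]
  have haS : (a : ℂ) ∈ S := by simp [hS, Real.pi_pos]
  have hac : (a : ℂ) ≠ 0 := by exact_mod_cast ha.ne'
  have hea : Complex.exp a - 1 ≠ 0 := by
    have : Real.exp a ≠ 1 := by simp [ha.ne']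
    rw [sub_ne_zero]; exact_mod_cast this
  set q : ℂ → ℂ := fun z => 1 - Complex.exp (a - z) with hq
  have hqd : Differentiable ℂ q := by fun_prop
  have hqa : q a = 0 := by simp [hq]
  set φ := dslope q a with hφ
  have hφd : DifferentiableOn ℂ φ S :=
    (Complex.differentiableOn_dslope (hSo.mem_nhds haS)).2 hqd.differentiableOn
  have hφa : φ a = 1 := by
    rw [hφ, dslope_same]
    have h1 : HasDerivAt (fun z : ℂ => (a : ℂ) - z) (-1) (a : ℂ) := (hasDerivAt_id' (a : ℂ)).const_sub (a : ℂ)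
    have := (h1.cexp).const_sub (1 : ℂ)
    rw [this.deriv]; simp
  have hφne : ∀ z : ℂ, z ≠ a → φ z = q z / (z - a) := by
    intro z hz
    rw [hφ, dslope_of_ne _ hz, slope_def_field, hqa, sub_zero]
  have hqne : ∀ z ∈ S, z ≠ (a : ℂ) → q z ≠ 0 := by
    intro z hz hza h
    have h1 : Complex.exp (a - z) = 1 := by
      have : 1 - Complex.exp (a - z) = 0 := h
      linear_combination -this
    obtain ⟨n, hn⟩ := Complex.exp_eq_one_iff.1 h1
    have him := congrArg Complex.im hn
    simp at him
    have h2 : |z.im| < 2 * Real.pi := hz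
    have h3 : |(n : ℝ)| * (2 * Real.pi) < 1 * (2 * Real.pi) := by
      rw [one_mul]
      calc |(n : ℝ)| * (2 * Real.pi) = |(n : ℝ) * (2 * Real.pi)| := by
            rw [abs_mul, abs_of_pos (a := 2 * Real.pi) (by positivity)]
        _ = |z.im| := by rw [← him, abs_neg]
        _ < _ := h2
    have h4 : |(n : ℝ)| < 1 := lt_of_mul_lt_mul_right h3 (by positivity)
    have h5 : n = 0 := by
      have : |n| < 1 := by exact_mod_cast h4
      exact Int.abs_lt_one_iff.1 this
    subst h5
    apply hza
    simp at hn
    linear_combination -hn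
  have hφ0 : ∀ z ∈ S, φ z ≠ 0 := by
    intro z hz
    by_cases h : z = a
    · rw [h, hφa]; exact one_ne_zero
    · rw [hφne z h]; exact div_ne_zero (hqne z hz h) (sub_ne_zero.2 h)
  set P : ℂ → ℂ := fun z => (φ z)⁻¹ with hP
  have hPd : DifferentiableOn ℂ P S := hφd.inv hφ0
  refine ⟨fun z => (1 / a : ℂ) * (dslope P a z - dslope P 0 z), ?_, ?_⟩
  · exact (((Complex.differentiableOn_dslope (hSo.mem_nhds haS)).2 hPd).sub
      ((Complex.differentiableOn_dslope (hSo.mem_nhds h0S)).2 hPd)).const_mul _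
  · intro z hz hz0 hza
    have hPa : P a = 1 := by simp [hP, hφa]
    have hP0 : P 0 = a / (Complex.exp a - 1) := by
      simp only [hP]
      rw [hφne 0 (Ne.symm hac)]
      simp only [hq, sub_zero, zero_sub]
      rw [inv_div, ← neg_sub (Complex.exp a) 1, neg_div_neg_eq]
    have hPz : P z = (z - a) / q z := by
      simp only [hP]; rw [hφne z hza, inv_div]
    have hqz := hqne z hz hza
    have hza' := sub_ne_zero.2 hza
    simp only [dslope_of_ne _ hza, dslope_of_ne _ hz0, slope_def_field, hPa, hP0, hPz]
    change _ = 1 / (z * q z) - _ + _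
    rw [sub_zero]
    field_simp
    ring

lemma g_bound (a : ℝ) (ha : 0 < a) : ∃ K : ℝ, ∀ z : ℂ, 2 * a ≤ |z.re| →
    ‖1 / (z * (1 - Complex.exp (a - z))) - (1 / a : ℂ) / (z - a)
        + (1 / (Complex.exp a - 1)) / z‖ ≤ K / |z.re| := by
  set δ := 1 - Real.exp (-a) with hδ
  have hδ0 : 0 < δ := by simp [hδ, ha]
  refine ⟨1 / δ + (1 / a) * 2 + ‖(1 / (Complex.exp a - 1))‖, ?_⟩
  intro z hz
  have hR : 0 < |z.re| := by linarith
  have hzn : |z.re| ≤ ‖z‖ := Complex.abs_re_le_norm z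
  have hzan : |z.re| / 2 ≤ ‖z - a‖ := by
    have h1 : |(z - a).re| ≤ ‖z - a‖ := Complex.abs_re_le_norm _
    have h2 : |z.re| - |a| ≤ |z.re - a| := abs_sub_abs_le_abs_sub _ _
    rw [abs_of_pos ha] at h2
    simp at h1
    linarith
  have hq : δ ≤ ‖1 - Complex.exp (a - z)‖ := by
    have h1 : ‖Complex.exp (a - z)‖ = Real.exp (a - z.re) := by
      rw [Complex.norm_exp]; simp
    have h2 := abs_norm_sub_norm_le (1 : ℂ) (Complex.exp (a - z))
    rw [h1, norm_one] at h2
    refine le_trans ?_ h2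
    rcases abs_cases z.re with ⟨h, _⟩ | ⟨h, _⟩
    · refine le_trans ?_ (le_abs_self _)
      have : Real.exp (a - z.re) ≤ Real.exp (-a) := Real.exp_le_exp.2 (by linarith)
      linarith
    · refine le_trans ?_ (neg_le_abs _)
      have h3 : a + 1 ≤ Real.exp a := Real.add_one_le_exp a
      have h4 : -a + 1 ≤ Real.exp (-a) := Real.add_one_le_exp (-a)
      have : Real.exp a ≤ Real.exp (a - z.re) := Real.exp_le_exp.2 (by linarith)
      linarith
  have e1 : ‖1 / (z * (1 - Complex.exp (a - z)))‖ ≤ 1 / δ / |z.re| := by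
    rw [norm_div, norm_mul, norm_one, div_div, mul_comm δ]
    gcongr
  have e2 : ‖(1 / a : ℂ) / (z - a)‖ ≤ (1 / a) * 2 / |z.re| := by
    rw [norm_div, norm_div, norm_one, Complex.norm_real, Real.norm_eq_abs, abs_of_pos ha]
    calc 1 / a / ‖z - a‖ ≤ 1 / a / (|z.re| / 2) := by gcongr
      _ = _ := by field_simp
  have e3 : ‖(1 / (Complex.exp a - 1)) / z‖ ≤ ‖(1 / (Complex.exp a - 1))‖ / |z.re| := by
    rw [norm_div]
    gcongr
  calc _ ≤ _ := norm_add_le_of_le (norm_sub_le_of_le e1 e2) e3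
    _ = _ := by ring

lemma cauchy_int : Integrable (fun u : ℝ => (u ^ 2 + Real.pi ^ 2)⁻¹) := by
  have h := (integrable_inv_one_add_sq.comp_mul_left' (R := Real.pi⁻¹) (by positivity)).const_mul
    ((Real.pi ^ 2)⁻¹)
  refine h.congr (Eventually.of_forall fun u => ?_)
  have := Real.pi_pos
  simp only
  field_simp
  ring

lemma cauchy_val : ∫ u : ℝ, (u ^ 2 + Real.pi ^ 2)⁻¹ = 1 := by
  have h := Measure.integral_comp_mul_left (fun x : ℝ => (1 + x ^ 2)⁻¹) Real.pi⁻¹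
  have hp := Real.pi_pos
  have : (fun u : ℝ => (u ^ 2 + Real.pi ^ 2)⁻¹)
      = fun u => (Real.pi ^ 2)⁻¹ * (1 + (Real.pi⁻¹ * u) ^ 2)⁻¹ := by
    ext u
    field_simp
    ring
  rw [this, integral_const_mul, h, integral_univ_inv_one_add_sq, inv_inv, abs_of_pos hp, smul_eq_mul]
  field_simp

lemma J_int (a : ℝ) :
    Integrable (fun u : ℝ => (u ^ 2 + Real.pi ^ 2)⁻¹ * (1 + Real.exp (a - u))⁻¹) := by
  refine cauchy_int.mono' (by fun_prop) (Eventually.of_forall fun u => ?_)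
  have := Real.exp_pos (a - u)
  have h2 : (1 + Real.exp (a - u))⁻¹ ≤ 1 := inv_le_one_of_one_le₀ (by linarith)
  have h3 : 0 ≤ (u ^ 2 + Real.pi ^ 2)⁻¹ := by positivity
  rw [Real.norm_of_nonneg (by positivity)]
  exact mul_le_of_le_one_right h3 h2

lemma J_val (a : ℝ) (ha : 0 < a) :
    ∫ u : ℝ, (u ^ 2 + Real.pi ^ 2)⁻¹ * (1 + Real.exp (a - u))⁻¹ = 1 / a - 1 / (Real.exp a - 1) := by
  obtain ⟨g, hgd, hg⟩ := exists_g a ha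
  obtain ⟨K, hK⟩ := g_bound a ha
  have hp := Real.pi_pos
  set c := 1 / (Real.exp a - 1) with hc
  set D : ℝ → ℝ := fun u => (u ^ 2 + Real.pi ^ 2)⁻¹ * (1 + Real.exp (a - u))⁻¹
    - (1 / a) * ((u - a) ^ 2 + Real.pi ^ 2)⁻¹ + c * (u ^ 2 + Real.pi ^ 2)⁻¹ with hD
  have i2 : Integrable (fun u : ℝ => (1 / a) * ((u - a) ^ 2 + Real.pi ^ 2)⁻¹) :=
    (cauchy_int.comp_sub_right a).const_mul _
  have i3 : Integrable (fun u : ℝ => c * (u ^ 2 + Real.pi ^ 2)⁻¹) := cauchy_int.const_mul _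
  have hDi : Integrable D := ((J_int a).sub i2).add i3
  have hDv : ∫ u, D u = (∫ u : ℝ, (u ^ 2 + Real.pi ^ 2)⁻¹ * (1 + Real.exp (a - u))⁻¹) - 1 / a + c := by
    have e1 : ∫ u, D u = (∫ u : ℝ, ((u ^ 2 + Real.pi ^ 2)⁻¹ * (1 + Real.exp (a - u))⁻¹
      - (1 / a) * ((u - a) ^ 2 + Real.pi ^ 2)⁻¹)) + ∫ u : ℝ, c * (u ^ 2 + Real.pi ^ 2)⁻¹ :=
      integral_add ((J_int a).sub i2) i3
    rw [e1, integral_sub (J_int a) i2, integral_const_mul, integral_const_mul, cauchy_val,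
      integral_sub_right_eq_self (fun u : ℝ => (u ^ 2 + Real.pi ^ 2)⁻¹) a, cauchy_val]
    ring
  -- the horizontal sides
  have hex : ∀ u : ℝ, Complex.exp (a - (u + (Real.pi : ℂ) * Complex.I)) = -Real.exp (a - u) := by
    intro u
    rw [show (a - (u + (Real.pi : ℂ) * Complex.I)) = (a - u) - Real.pi * Complex.I by ring,
      Complex.exp_sub, Complex.exp_pi_mul_I]
    push_cast; ring
  have hex' : ∀ u : ℝ, Complex.exp (a - (u + ((-Real.pi : ℝ) : ℂ) * Complex.I)) = -Real.exp (a - u) := by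
    intro u
    rw [show (a - (u + ((-Real.pi : ℝ) : ℂ) * Complex.I)) = (a - u) + Real.pi * Complex.I by push_cast; ring,
      Complex.exp_add, Complex.exp_pi_mul_I]
    push_cast; ring
  have hne : ∀ (u v y : ℝ), y ≠ 0 → (u : ℂ) + y * Complex.I ≠ v := by
    intro u v y hy h
    have := congrArg Complex.im h
    simp at this
    exact hy this
  have hor : ∀ u : ℝ, g (u + ((-Real.pi : ℝ) : ℂ) * Complex.I) - g (u + (Real.pi : ℂ) * Complex.I)
      = 2 * Real.pi * Complex.I * (D u : ℂ) := by
    intro u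
    have n1 := hne u 0 Real.pi hp.ne'
    have n2 := hne u a Real.pi hp.ne'
    have n3 := hne u 0 (-Real.pi) (neg_ne_zero.2 hp.ne')
    have n4 := hne u a (-Real.pi) (neg_ne_zero.2 hp.ne')
    rw [Complex.ofReal_zero] at n1 n3
    rw [hg _ (by simp [abs_of_pos hp]; linarith) n1 n2,
      hg _ (by simp [abs_of_pos hp]; linarith) n3 n4, hex, hex']
    have n2' := sub_ne_zero.2 n2
    have n4' := sub_ne_zero.2 n4
    have hE : (1 + Real.exp (a - u) : ℂ) ≠ 0 := by
      have : (1 + Real.exp (a - u)) ≠ 0 := by positivity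
      exact_mod_cast this
    have hkey : ∀ v : ℝ, ((v + ((-Real.pi : ℝ) : ℂ) * Complex.I) * (v + (Real.pi : ℂ) * Complex.I)) = ((v ^ 2 + Real.pi ^ 2 : ℝ) : ℂ) := by
      intro v
      push_cast
      linear_combination (-(Real.pi : ℂ) ^ 2) * Complex.I_sq
    have hdiff : ∀ v : ℝ, 1 / (v + ((-Real.pi : ℝ) : ℂ) * Complex.I) - 1 / (v + (Real.pi : ℂ) * Complex.I)
        = 2 * Real.pi * Complex.I * ((v ^ 2 + Real.pi ^ 2 : ℝ) : ℂ)⁻¹ := by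
      intro v
      have m1 := hne v 0 Real.pi hp.ne'
      have m3 := hne v 0 (-Real.pi) (neg_ne_zero.2 hp.ne')
      rw [Complex.ofReal_zero] at m1 m3
      rw [← hkey, div_sub_div _ _ m3 m1, div_eq_mul_inv]
      congr 1
      push_cast; ring
    have d1 := hdiff u
    have d2 := hdiff (u - a)
    have r1 : ((u - a : ℝ) : ℂ) + ((-Real.pi : ℝ) : ℂ) * Complex.I = u + ((-Real.pi : ℝ) : ℂ) * Complex.I - a := by
      push_cast; ring
    have r2 : ((u - a : ℝ) : ℂ) + (Real.pi : ℂ) * Complex.I = u + (Real.pi : ℂ) * Complex.I - a := by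
      push_cast; ring
    rw [r1, r2] at d2
    have hDc : (D u : ℂ) = ((u ^ 2 + Real.pi ^ 2 : ℝ) : ℂ)⁻¹ * (1 + Real.exp (a - u) : ℂ)⁻¹
        - (1 / a : ℂ) * (((u - a) ^ 2 + Real.pi ^ 2 : ℝ) : ℂ)⁻¹ + c * ((u ^ 2 + Real.pi ^ 2 : ℝ) : ℂ)⁻¹ := by
      simp only [hD]; push_cast; ring
    have hcc : (1 / (Complex.exp a - 1)) = (c : ℂ) := by simp [hc]
    rw [hDc, hcc, sub_neg_eq_add]
    simp only [div_eq_mul_inv, one_mul, mul_inv] at d1 d2 ⊢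
    linear_combination ((1 + Real.exp (a - u) : ℂ)⁻¹ + c) * d1 - (a : ℂ)⁻¹ * d2
  have hcont : ∀ y : ℝ, |y| < 2 * Real.pi → Continuous (fun u : ℝ => g (u + y * Complex.I)) := by
    intro y hy
    refine hgd.continuousOn.comp_continuous (by fun_prop) ?_
    intro u; simpa using hy
  have rect : ∀ R : ℝ, (2 * Real.pi * Complex.I * ((∫ u in (-R)..R, D u : ℝ) : ℂ)
      + Complex.I • ∫ y in (-Real.pi)..Real.pi, g (R + y * Complex.I))
      - Complex.I • ∫ y in (-Real.pi)..Real.pi, g ((-R : ℝ) + y * Complex.I) = 0 := by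
    intro R
    have := Complex.integral_boundary_rect_eq_zero_of_differentiableOn g ⟨-R, -Real.pi⟩ ⟨R, Real.pi⟩
      (hgd.mono (by
        intro z hz
        have h2 := hz.2
        simp only [Set.mem_preimage] at h2
        rw [Set.uIcc_of_le (by linarith)] at h2
        have : |z.im| ≤ Real.pi := abs_le.2 h2
        change |z.im| < _
        linarith))
    simp only at this
    rw [← intervalIntegral.integral_sub] at this
    · simp only [hor] at this
      rw [intervalIntegral.integral_const_mul, intervalIntegral.integral_ofReal] at this
      exact this
    · exact (hcont _ (by rw [abs_neg, abs_of_pos hp]; linarith)).intervalIntegrable _ _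
    · exact (hcont _ (by rw [abs_of_pos hp]; linarith)).intervalIntegrable _ _
  have vb : ∀ r : ℝ, 2 * a ≤ |r| →
      ‖∫ y in (-Real.pi)..Real.pi, g (r + y * Complex.I)‖ ≤ K / |r| * |Real.pi - -Real.pi| := by
    intro r hr
    apply intervalIntegral.norm_integral_le_of_norm_le_const
    intro y hy
    rw [Set.uIoc_of_le (by linarith)] at hy
    have hr0 : r ≠ 0 := by rintro rfl; simp at hr; linarith
    have hra : r ≠ a := by rintro rfl; rw [abs_of_pos ha] at hr; linarith
    rw [hg]
    · have := hK (r + y * Complex.I) (by simpa using hr)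
      simpa using this
    · have : |y| ≤ Real.pi := abs_le.2 ⟨hy.1.le, hy.2⟩
      simp; linarith
    · intro h; have := congrArg Complex.re h; simp at this; exact hr0 this
    · intro h; have := congrArg Complex.re h; simp at this; exact hra this
  have hb0 : Tendsto (fun R : ℝ => K / |R| * |Real.pi - -Real.pi|) atTop (𝓝 0) := by
    have := ((tendsto_const_nhds (x := K)).div_atTop tendsto_abs_atTop_atTop).mul_const |Real.pi - -Real.pi|
    simpa using this
  have l1 : Tendsto (fun R : ℝ => ∫ y in (-Real.pi)..Real.pi, g (R + y * Complex.I)) atTop (𝓝 0) := by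
    refine squeeze_zero_norm' ?_ hb0
    filter_upwards [eventually_ge_atTop (2 * a)] with R hR
    exact vb R (hR.trans (le_abs_self _))
  have l2 : Tendsto (fun R : ℝ => ∫ y in (-Real.pi)..Real.pi, g ((-R : ℝ) + y * Complex.I)) atTop (𝓝 0) := by
    refine squeeze_zero_norm' ?_ hb0
    filter_upwards [eventually_ge_atTop (2 * a)] with R hR
    have := vb (-R) (by rw [abs_neg]; exact hR.trans (le_abs_self _))
    rwa [abs_neg] at this
  have l0 : Tendsto (fun R : ℝ => ∫ u in (-R)..R, D u) atTop (𝓝 (∫ u, D u)) :=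
    intervalIntegral_tendsto_integral hDi tendsto_neg_atTop_atBot tendsto_id
  have lt := (((Complex.continuous_ofReal.tendsto _).comp l0).const_mul (2 * Real.pi * Complex.I)).add
    (l1.const_smul Complex.I) |>.sub (l2.const_smul Complex.I)
  have lim := tendsto_nhds_unique (lt.congr fun R => rect R) tendsto_const_nhds
  simp only [smul_zero, add_zero, sub_zero] at lim
  have h2 : (2 * Real.pi * Complex.I : ℂ) ≠ 0 := Complex.two_pi_I_ne_zero
  have h3 := (mul_eq_zero.1 lim).resolve_left h2
  have h4 : ∫ u, D u = 0 := by exact_mod_cast h3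
  rw [hDv] at h4
  linarith

lemma image_one_add_exp : (fun u : ℝ => 1 + Real.exp u) '' Set.univ = Set.Ioi 1 := by
  ext t
  simp only [Set.image_univ, Set.mem_range, Set.mem_Ioi]
  constructor
  · rintro ⟨u, rfl⟩
    have := Real.exp_pos u
    linarith
  · intro h
    exact ⟨Real.log (t - 1), by rw [Real.exp_log (by linarith)]; ring⟩

lemma hasDeriv_one_add_exp : ∀ u ∈ (Set.univ : Set ℝ),
    HasDerivWithinAt (fun u : ℝ => 1 + Real.exp u) (Real.exp u) Set.univ u := fun u _ =>
  ((Real.hasDerivAt_exp u).const_add 1).hasDerivWithinAt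

lemma inj_one_add_exp : Set.InjOn (fun u : ℝ => 1 + Real.exp u) Set.univ := by
  intro u _ v _ h
  simpa using h

lemma subst_aux (x : ℝ) (hx : 0 ≤ x) (u : ℝ) :
    |Real.exp u| • (1 / (((Real.log ((1 + Real.exp u) - 1)) ^ 2 + Real.pi ^ 2) * (x + (1 + Real.exp u))))
      = (u ^ 2 + Real.pi ^ 2)⁻¹ * (1 + Real.exp (Real.log (1 + x) - u))⁻¹ := by
  have h := Real.exp_pos u
  have hp := Real.pi_pos
  rw [abs_of_pos h, smul_eq_mul, add_sub_cancel_left, Real.log_exp, Real.exp_sub,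
    Real.exp_log (by linarith)]
  have : 0 < x + (1 + Real.exp u) := by linarith
  have : 0 < 1 + (1 + x) / Real.exp u := by positivity
  field_simp
  ring

lemma base_int (x : ℝ) (hx : 0 ≤ x) :
    IntegrableOn (fun t : ℝ => 1 / (((Real.log (t - 1)) ^ 2 + Real.pi ^ 2) * (x + t))) (Set.Ioi 1) := by
  rw [← image_one_add_exp, integrableOn_image_iff_integrableOn_abs_deriv_smul MeasurableSet.univ
    hasDeriv_one_add_exp inj_one_add_exp]
  simp only [subst_aux x hx]
  exact (J_int _).integrableOn

lemma base_val (x : ℝ) (hx : 0 < x) :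
    ∫ t in Set.Ioi (1 : ℝ), 1 / (((Real.log (t - 1)) ^ 2 + Real.pi ^ 2) * (x + t))
      = 1 / Real.log (1 + x) - 1 / x := by
  rw [← image_one_add_exp, integral_image_eq_integral_abs_deriv_smul MeasurableSet.univ
    hasDeriv_one_add_exp inj_one_add_exp]
  simp only [subst_aux x hx.le]
  rw [setIntegral_univ, J_val _ (Real.log_pos (by linarith)), Real.exp_log (by linarith)]
  simp

lemma bound_int :
    IntegrableOn (fun t : ℝ => 1 / (((Real.log (t - 1)) ^ 2 + Real.pi ^ 2) * t)) (Set.Ioi 1) := by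
  simpa using base_int 0 le_rfl

lemma term_bound (k : ℕ) (hk : 1 ≤ k) (x : ℝ) (hx : 0 < x) (t : ℝ) (ht : 1 < t) :
    |t / (((Real.log (t - 1)) ^ 2 + Real.pi ^ 2) * (x + t) ^ (k + 1))|
      ≤ 1 / (((Real.log (t - 1)) ^ 2 + Real.pi ^ 2) * t) := by
  have ht0 : 0 < t := by linarith
  have hw : 0 < (Real.log (t - 1)) ^ 2 + Real.pi ^ 2 := by
    have := Real.pi_pos
    positivity
  have h1 : t ^ 2 ≤ (x + t) ^ (k + 1) :=
    calc t ^ 2 ≤ (x + t) ^ 2 := by gcongr; linarith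
      _ ≤ (x + t) ^ (k + 1) := pow_le_pow_right₀ (by linarith) (by omega)
  rw [abs_of_pos (by positivity)]
  calc t / (((Real.log (t - 1)) ^ 2 + Real.pi ^ 2) * (x + t) ^ (k + 1))
      ≤ t / (((Real.log (t - 1)) ^ 2 + Real.pi ^ 2) * t ^ 2) := by gcongr
    _ = _ := by field_simp

lemma deriv_base (x : ℝ) (hx : 0 < x) :
    HasDerivAt (fun x : ℝ => ∫ t in Set.Ioi (1 : ℝ),
        x / (((Real.log (t - 1)) ^ 2 + Real.pi ^ 2) * (x + t)))
      (∫ t in Set.Ioi (1 : ℝ), t / (((Real.log (t - 1)) ^ 2 + Real.pi ^ 2) * (x + t) ^ (1 + 1))) x := by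
  refine (hasDerivAt_integral_of_dominated_loc_of_deriv_le (s := Set.Ioi 0)
    (F := fun x t => x / (((Real.log (t - 1)) ^ 2 + Real.pi ^ 2) * (x + t)))
    (F' := fun x t => t / (((Real.log (t - 1)) ^ 2 + Real.pi ^ 2) * (x + t) ^ (1 + 1)))
    (bound := fun t => 1 / (((Real.log (t - 1)) ^ 2 + Real.pi ^ 2) * t))
    (Ioi_mem_nhds hx) ?_ ?_ ?_ ?_ bound_int ?_).2
  · exact Eventually.of_forall fun y => Measurable.aestronglyMeasurable (by fun_prop)
  · refine ((base_int x hx.le).const_mul x).congr (Eventually.of_forall fun t => ?_)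
    simp only
    ring
  · exact Measurable.aestronglyMeasurable (by fun_prop)
  · filter_upwards [ae_restrict_mem measurableSet_Ioi] with t ht y hy
    exact term_bound 1 le_rfl y hy t ht
  · filter_upwards [ae_restrict_mem measurableSet_Ioi] with t ht y hy
    have ht' : (1 : ℝ) < t := ht
    have hy' : (0 : ℝ) < y := hy
    have hw : 0 < (Real.log (t - 1)) ^ 2 + Real.pi ^ 2 := by
      have := Real.pi_pos
      positivity
    have hyt : 0 < y + t := by linarith
    have := (hasDerivAt_id' y).div (((hasDerivAt_id' y).add_const t).const_mul
      ((Real.log (t - 1)) ^ 2 + Real.pi ^ 2)) (by positivity)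
    refine this.congr_deriv ?_
    field_simp
    ring

lemma deriv_step (k : ℕ) (hk : 1 ≤ k) (x : ℝ) (hx : 0 < x) :
    HasDerivAt (fun x : ℝ => ∫ t in Set.Ioi (1 : ℝ),
        t / (((Real.log (t - 1)) ^ 2 + Real.pi ^ 2) * (x + t) ^ (k + 1)))
      (-(k + 1 : ℝ) * ∫ t in Set.Ioi (1 : ℝ),
        t / (((Real.log (t - 1)) ^ 2 + Real.pi ^ 2) * (x + t) ^ (k + 1 + 1))) x := by
  rw [← integral_const_mul]
  refine (hasDerivAt_integral_of_dominated_loc_of_deriv_le (s := Set.Ioi 0)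
    (F := fun x t => t / (((Real.log (t - 1)) ^ 2 + Real.pi ^ 2) * (x + t) ^ (k + 1)))
    (F' := fun x t => -(k + 1 : ℝ) * (t / (((Real.log (t - 1)) ^ 2 + Real.pi ^ 2) * (x + t) ^ (k + 1 + 1))))
    (bound := fun t => (k + 1 : ℝ) * (1 / (((Real.log (t - 1)) ^ 2 + Real.pi ^ 2) * t)))
    (Ioi_mem_nhds hx) ?_ ?_ ?_ ?_ (bound_int.const_mul _) ?_).2
  · exact Eventually.of_forall fun y => Measurable.aestronglyMeasurable (by fun_prop)
  · refine Integrable.mono' bound_int (Measurable.aestronglyMeasurable (by fun_prop)) ?_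
    filter_upwards [ae_restrict_mem measurableSet_Ioi] with t ht
    exact term_bound k hk x hx t ht
  · exact Measurable.aestronglyMeasurable (by fun_prop)
  · filter_upwards [ae_restrict_mem measurableSet_Ioi] with t ht y hy
    rw [Real.norm_eq_abs, abs_mul, abs_neg, abs_of_pos (by positivity : (0 : ℝ) < k + 1)]
    exact mul_le_mul_of_nonneg_left (term_bound (k + 1) (by omega) y hy t ht) (by positivity)
  · filter_upwards [ae_restrict_mem measurableSet_Ioi] with t ht y hy
    have ht' : (1 : ℝ) < t := ht
    have hy' : (0 : ℝ) < y := hy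
    have hw : 0 < (Real.log (t - 1)) ^ 2 + Real.pi ^ 2 := by
      have := Real.pi_pos
      positivity
    have hyt : 0 < y + t := by linarith
    have hpow : HasDerivAt (fun y : ℝ => (y + t) ^ (k + 1)) ((k + 1 : ℕ) * (y + t) ^ k * 1) y :=
      ((hasDerivAt_id' y).add_const t).pow (k + 1)
    have := (hasDerivAt_const y t).div (hpow.const_mul
      ((Real.log (t - 1)) ^ 2 + Real.pi ^ 2)) (by positivity)
    refine this.congr_deriv ?_
    push_cast
    field_simp
    ring

lemma repr_val (x : ℝ) (hx : 0 < x) : x / Real.log (1 + x) =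
    1 + ∫ t in Set.Ioi (1 : ℝ), x / (((Real.log (t - 1)) ^ 2 + Real.pi ^ 2) * (x + t)) := by
  have h : ∀ t : ℝ, x / (((Real.log (t - 1)) ^ 2 + Real.pi ^ 2) * (x + t))
      = x * (1 / (((Real.log (t - 1)) ^ 2 + Real.pi ^ 2) * (x + t))) := fun t => by ring
  simp only [h]
  rw [integral_const_mul, base_val x hx]
  field_simp
  ring

/-- For every integer `k ≥ 1` and every real `x > 0`,
`(d/dx)^k [x/ln(1+x)] = (-1)^{k+1} k! ∫₁^∞ t/(((ln(t-1))² + π²)·(x+t)^{k+1}) dt`. -/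
theorem stmt_14 (k : ℕ) (hk : 1 ≤ k) (x : ℝ) (hx : 0 < x) :
    iteratedDeriv k (fun x : ℝ => x / Real.log (1 + x)) x =
      (-1 : ℝ) ^ (k + 1) * (Nat.factorial k) *
        ∫ t in Set.Ioi (1 : ℝ),
          t / (((Real.log (t - 1)) ^ 2 + Real.pi ^ 2) * (x + t) ^ (k + 1)) := by
  induction k, hk using Nat.le_induction generalizing x with
  | base =>
    rw [iteratedDeriv_one]
    have h : (fun x : ℝ => x / Real.log (1 + x)) =ᶠ[𝓝 x] fun x => 1 +
        ∫ t in Set.Ioi (1 : ℝ), x / (((Real.log (t - 1)) ^ 2 + Real.pi ^ 2) * (x + t)) := by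
      filter_upwards [Ioi_mem_nhds hx] with y hy
      exact repr_val y hy
    rw [h.deriv_eq, ((deriv_base x hx).const_add 1).deriv]
    simp
  | succ k hk ih =>
    rw [iteratedDeriv_succ]
    have h : iteratedDeriv k (fun x : ℝ => x / Real.log (1 + x)) =ᶠ[𝓝 x] fun x =>
        (-1 : ℝ) ^ (k + 1) * (Nat.factorial k) * ∫ t in Set.Ioi (1 : ℝ),
          t / (((Real.log (t - 1)) ^ 2 + Real.pi ^ 2) * (x + t) ^ (k + 1)) := by
      filter_upwards [Ioi_mem_nhds hx] with y hy
      exact ih y hy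
    rw [h.deriv_eq, ((deriv_step k hk x hx).const_mul _).deriv, Nat.factorial_succ]
    push_cast
    ring
end

section
/- For every real x > 0, one has x/ln(1+x) = ∫₁^∞ t/((t-1)·((ln(t-1))² + π²)) · (1+x)/(x+t) dt, where the integral is over t ∈ (1, ∞). -/
open MeasureTheory Real

lemma exists_K (L : ℝ) (hL : 0 < L) : ∃ K : ℂ → ℂ,
    DifferentiableOn ℂ K {z | |z.im| < 2 * π} ∧
    ∀ z : ℂ, |z.im| < 2 * π → z ≠ 0 → z ≠ L →
      K z = (Complex.exp z - 1) * Complex.exp L / ((Complex.exp L - Complex.exp z) * z)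
        + ((Complex.exp L - 1) / L) / (z - L) := by
  have hLc : (L : ℂ) ≠ 0 := by exact_mod_cast hL.ne'
  have hopen : IsOpen {z : ℂ | |z.im| < 2 * π} :=
    isOpen_lt (by fun_prop) (by fun_prop)
  have hd : ∀ w : ℂ, DifferentiableOn ℂ (dslope Complex.exp w) Set.univ := fun w =>
    (Complex.differentiableOn_dslope Filter.univ_mem).2 Complex.differentiable_exp.differentiableOn
  have hne : ∀ z : ℂ, |z.im| < 2 * π → z ≠ L → Complex.exp z ≠ Complex.exp L := by
    intro z hz hzL h
    obtain ⟨n, hn⟩ := Complex.exp_eq_exp_iff_exists_int.1 h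
    have him : z.im = n * (2 * π) := by rw [hn]; simp
    have hn0 : n = 0 := by
      by_contra h0
      have : (1 : ℝ) ≤ |(n : ℝ)| := by exact_mod_cast Int.one_le_abs h0
      rw [him, abs_mul, abs_of_pos (a := 2 * π) (by positivity)] at hz
      nlinarith [Real.pi_pos]
    apply hzL; rw [hn, hn0]; simp
  have hne0 : ∀ z : ℂ, |z.im| < 2 * π → dslope Complex.exp L z ≠ 0 := by
    intro z hz
    by_cases h : z = L
    · rw [h, dslope_same]; simp
    · rw [dslope_of_ne _ h, slope_def_field]
      exact div_ne_zero (sub_ne_zero.2 (hne z hz h)) (sub_ne_zero.2 h)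
  refine ⟨dslope (fun z => -(dslope Complex.exp 0 z) * Complex.exp L / dslope Complex.exp L z) L,
    ?_, ?_⟩
  · apply (Complex.differentiableOn_dslope (hopen.mem_nhds (by simp; positivity))).2
    exact ((((hd 0).mono (Set.subset_univ _)).neg).mul_const _).div
      ((hd L).mono (Set.subset_univ _)) hne0
  · intro z hz hz0 hzL
    have h1 := sub_ne_zero.2 (hne z hz hzL)
    have h1' := sub_ne_zero.2 (hne z hz hzL).symm
    have h2 := sub_ne_zero.2 hzL
    have h3 := Complex.exp_ne_zero L
    rw [dslope_of_ne _ hzL, slope_def_field, dslope_same, dslope_of_ne _ hzL, dslope_of_ne _ hz0,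
      dslope_of_ne _ hLc, slope_def_field, slope_def_field, slope_def_field]
    simp only [Complex.deriv_exp, Complex.exp_zero, sub_zero]
    have h4 : Complex.exp L - Complex.exp z = -(Complex.exp z - Complex.exp L) := by ring
    rw [h4]
    field_simp
    ring

lemma side_bound (L : ℝ) (hL : 0 < L) (z : ℂ) (R : ℝ) (hR : 1 ≤ R) (hR1 : L + 1 ≤ R)
    (hR2 : 2 * L ≤ R)
    (hz : z.re = R ∨ z.re = -R) :
    ‖(Complex.exp z - 1) * Complex.exp L / ((Complex.exp L - Complex.exp z) * z)
        + ((Complex.exp L - 1) / L) / (z - L)‖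
      ≤ (4 * Real.exp L + 2 * ‖(Complex.exp L - 1) / L‖) / R := by
  have hR0 : 0 < R := by linarith
  have hnz : R ≤ ‖z‖ := by
    refine le_trans ?_ (Complex.abs_re_le_norm z)
    rcases hz with h | h <;> rw [h] <;> [skip; rw [abs_neg]] <;> exact le_abs_self _
  have hnzL : R / 2 ≤ ‖z - L‖ := by
    refine le_trans ?_ (Complex.abs_re_le_norm _)
    simp only [Complex.sub_re, Complex.ofReal_re]
    rcases hz with h | h <;> rw [h]
    · exact le_trans (by linarith) (le_abs_self _)
    · exact le_trans (by linarith) (neg_le_abs _)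
  have ha : 1 ≤ Real.exp L := Real.one_le_exp hL.le
  have hnL : ‖Complex.exp L‖ = Real.exp L := by simp [Complex.norm_exp]
  have he2 : 2 ≤ Real.exp 1 := by linarith [Real.add_one_le_exp 1]
  have hE : ‖Complex.exp z - 1‖ ≤ 4 * ‖Complex.exp L - Complex.exp z‖ ∧
     0 < ‖Complex.exp L - Complex.exp z‖ := by
    have t1 : ‖Complex.exp z - 1‖ ≤ ‖Complex.exp z‖ + 1 := by
      simpa using norm_sub_le (Complex.exp z) 1
    have t2 : ‖Complex.exp z‖ - ‖Complex.exp L‖ ≤ ‖Complex.exp L - Complex.exp z‖ := by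
      rw [norm_sub_rev]; exact norm_sub_norm_le _ _
    have t3 : ‖Complex.exp L‖ - ‖Complex.exp z‖ ≤ ‖Complex.exp L - Complex.exp z‖ :=
      norm_sub_norm_le _ _
    rw [hnL] at t2 t3
    rw [Complex.norm_exp] at t1 t2 t3
    rcases hz with h | h <;> rw [h] at t1 t2 t3
    · have : 2 * Real.exp L ≤ Real.exp R := by
        calc 2 * Real.exp L ≤ Real.exp 1 * Real.exp L := by gcongr
          _ = Real.exp (1 + L) := (Real.exp_add _ _).symm
          _ ≤ _ := Real.exp_le_exp.2 (by linarith)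
      constructor <;> linarith
    · have : 2 * Real.exp (-R) ≤ 1 := by
        calc 2 * Real.exp (-R) ≤ Real.exp 1 * Real.exp (-R) := by gcongr
          _ = Real.exp (1 + -R) := (Real.exp_add _ _).symm
          _ ≤ _ := Real.exp_le_one_iff.2 (by linarith)
      constructor <;> linarith
  rw [add_div]
  refine (norm_add_le _ _).trans (add_le_add ?_ ?_)
  · rw [norm_div, norm_mul, norm_mul, hnL]
    obtain ⟨h1, h2⟩ := hE
    have h3 : 0 < ‖z‖ := by linarith
    rw [div_le_div_iff₀ (by positivity) hR0]
    calc _ ≤ 4 * ‖Complex.exp L - Complex.exp z‖ * Real.exp L * ‖z‖ := by gcongr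
      _ = _ := by ring
  · rw [norm_div]
    have h3 : 0 < ‖z - L‖ := by linarith
    rw [div_le_div_iff₀ (by positivity) hR0]
    nlinarith [norm_nonneg ((Complex.exp L - 1) / (L:ℂ))]

lemma integrable_q : Integrable (fun u : ℝ => (u ^ 2 + π ^ 2)⁻¹) ∧
    ∫ u : ℝ, (u ^ 2 + π ^ 2)⁻¹ = 1 := by
  have h : (fun u : ℝ => (u ^ 2 + π ^ 2)⁻¹) = fun u => (π^2)⁻¹ * (1 + (u / π) ^ 2)⁻¹ := by
    funext u
    have := Real.pi_pos
    rw [← mul_inv]; congr 1; field_simp; ring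
  constructor
  · rw [h]
    exact (integrable_inv_one_add_sq.comp_div Real.pi_ne_zero).const_mul _
  · rw [h, integral_const_mul, Measure.integral_comp_div (fun u : ℝ => (1 + u^2)⁻¹),
      integral_univ_inv_one_add_sq, abs_of_pos Real.pi_pos]
    have := Real.pi_pos
    simp; field_simp

lemma integrable_W (L : ℝ) :
    Integrable (fun u : ℝ => (1 + Real.exp u) * Real.exp L / (Real.exp L + Real.exp u) *
      (u ^ 2 + π ^ 2)⁻¹) := by
  refine integrable_q.1.bdd_mul (c := 1 + Real.exp L) (Continuous.aestronglyMeasurable ?_)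
    (Filter.Eventually.of_forall fun u => ?_)
  · exact Continuous.div (by fun_prop) (by fun_prop) (fun u => by positivity)
  · rw [Real.norm_of_nonneg (by positivity), div_le_iff₀ (by positivity)]
    have := Real.exp_pos u
    have := Real.exp_pos L
    nlinarith [mul_pos this this]

open Filter Topology in
lemma main_int (L : ℝ) (hL : 0 < L) :
    ∫ u : ℝ, (1 + Real.exp u) * Real.exp L / (Real.exp L + Real.exp u) * (u ^ 2 + π ^ 2)⁻¹
      = (Real.exp L - 1) / L := by
  obtain ⟨K, hK, hKe⟩ := exists_K L hL
  set c : ℝ := (Real.exp L - 1) / L with hc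
  set q : ℝ → ℝ := fun u => (1 + Real.exp u) * Real.exp L / (Real.exp L + Real.exp u) *
    (u ^ 2 + π ^ 2)⁻¹ with hq
  set p : ℝ → ℝ := fun u => c * ((u - L) ^ 2 + π ^ 2)⁻¹ with hp
  have hpi := Real.pi_pos
  have hqi : Integrable q := integrable_W L
  have hpi' : Integrable p := (integrable_q.1.comp_sub_right L).const_mul c
  have hpv : ∫ u, p u = c := by
    rw [hp, integral_const_mul, integral_sub_right_eq_self (fun u : ℝ => (u ^ 2 + π ^ 2)⁻¹) L,
      integrable_q.2, mul_one]
  -- pointwise difference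
  have hdiff : ∀ u : ℝ, K (u + (-π : ℝ) * Complex.I) - K (u + (π : ℝ) * Complex.I)
      = (2 * π * Complex.I) * ((p u - q u : ℝ) : ℂ) := by
    intro u
    have e1 : Complex.exp (u + (-π : ℝ) * Complex.I) = -Complex.exp u := by
      rw [Complex.exp_add]; push_cast; rw [neg_mul, Complex.exp_neg, Complex.exp_pi_mul_I]
      norm_num
    have e2 : Complex.exp (u + (π : ℝ) * Complex.I) = -Complex.exp u := by
      rw [Complex.exp_add, Complex.exp_pi_mul_I]; ring
    have n1 : ∀ v : ℝ, ∀ s : ℝ, s ≠ 0 → (v : ℂ) + (s : ℝ) * Complex.I ≠ 0 := by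
      intro v s hs h
      have := congrArg Complex.im h
      simp at this; exact hs this
    have n2 : ∀ s : ℝ, s ≠ 0 → (u : ℂ) + (s : ℝ) * Complex.I ≠ L := by
      intro s hs h
      have := congrArg Complex.im h
      simp at this; exact hs this
    rw [hKe _ (by simp [abs_of_pos hpi]; linarith) (n1 u _ (by simpa using hpi.ne')) (n2 _ (by simpa using hpi.ne')),
      hKe _ (by simp [abs_of_pos hpi]; linarith) (n1 u _ hpi.ne') (n2 _ hpi.ne'), e1, e2]
    have m1 := n1 u π hpi.ne'
    have m2 := n1 u (-π) (by simpa using hpi.ne')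
    have m3 := n1 (u - L) π hpi.ne'
    have m4 := n1 (u - L) (-π) (by simpa using hpi.ne')
    have m5 : Complex.exp L + Complex.exp u ≠ 0 := by
      have : Real.exp L + Real.exp u ≠ 0 := by positivity
      exact_mod_cast this
    have hLc : (L : ℂ) ≠ 0 := by exact_mod_cast hL.ne'
    have f1 : ∀ v : ℝ, ((v:ℂ)^2 + (π:ℂ)^2) = (v + (π:ℝ) * Complex.I) * (v + (-π:ℝ) * Complex.I) := by
      intro v; push_cast; ring_nf; simp
    have f2 := f1 (u - L)
    have f3 := f1 u
    have g1 : (u : ℂ) + (π:ℝ) * Complex.I - L = ((u - L : ℝ) : ℂ) + (π:ℝ) * Complex.I := by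
      push_cast; ring
    have g2 : (u : ℂ) + (-π:ℝ) * Complex.I - L = ((u - L : ℝ) : ℂ) + (-π:ℝ) * Complex.I := by
      push_cast; ring
    rw [g1, g2]
    have hpc : ((p u : ℝ) : ℂ) = ((Complex.exp L - 1) / L) *
      ((((u - L : ℝ) : ℂ) + (π:ℝ) * Complex.I) * (((u - L : ℝ) : ℂ) + (-π:ℝ) * Complex.I))⁻¹ := by
      rw [← f2, hp, hc]; push_cast; rfl
    have hqc : ((q u : ℝ) : ℂ) = (1 + Complex.exp u) * Complex.exp L / (Complex.exp L + Complex.exp u) *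
      (((u : ℂ) + (π:ℝ) * Complex.I) * ((u : ℂ) + (-π:ℝ) * Complex.I))⁻¹ := by
      rw [← f3, hq]; push_cast; rfl
    rw [Complex.ofReal_sub (p u) (q u), hpc, hqc]
    have s1 : (2 * π * Complex.I) = (((u - L : ℝ) : ℂ) + (π:ℝ) * Complex.I) - (((u - L : ℝ) : ℂ) + (-π:ℝ) * Complex.I) := by
      push_cast; ring
    have s2 : (2 * π * Complex.I) = ((u : ℂ) + (π:ℝ) * Complex.I) - ((u : ℂ) + (-π:ℝ) * Complex.I) := by
      push_cast; ring
    rw [mul_sub]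
    nth_rewrite 1 [s1]
    rw [s2]
    generalize (((u - L : ℝ) : ℂ) + (π:ℝ) * Complex.I) = A at *
    generalize (((u - L : ℝ) : ℂ) + (-π:ℝ) * Complex.I) = B at *
    generalize ((u : ℂ) + (π:ℝ) * Complex.I) = C at *
    generalize ((u : ℂ) + (-π:ℝ) * Complex.I) = D at *
    rw [sub_neg_eq_add]
    field_simp
    ring
  have hmem : ∀ x y : ℝ, |y| ≤ π → |((x : ℂ) + y * Complex.I).im| < 2 * π := by
    intro x y hy; simp; linarith
  have hcont : ∀ y : ℝ, |y| ≤ π → Continuous (fun u : ℝ => K (u + (y : ℝ) * Complex.I)) := by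
    intro y hy
    exact hK.continuousOn.comp_continuous (by fun_prop) (fun u => hmem u y hy)
  have hrect : ∀ R : ℝ, (2 * π * Complex.I) * ((∫ u in (-R)..R, (p u - q u) : ℝ) : ℂ) =
      Complex.I • (∫ y in (-π)..π, K ((-R : ℝ) + y * Complex.I)) -
      Complex.I • (∫ y in (-π)..π, K ((R : ℝ) + y * Complex.I)) := by
    intro R
    have h := Complex.integral_boundary_rect_eq_zero_of_differentiableOn K
      ⟨-R, -π⟩ ⟨R, π⟩ (hK.mono ?_)
    · simp only at h
      rw [← intervalIntegral.integral_ofReal, ← intervalIntegral.integral_const_mul]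
      simp_rw [← hdiff]
      rw [intervalIntegral.integral_sub
        ((hcont _ (by simp [abs_of_pos hpi])).intervalIntegrable _ _)
        ((hcont _ (by simp [abs_of_pos hpi])).intervalIntegrable _ _)]
      linear_combination h
    · intro z hz
      rw [Complex.mem_reProdIm] at hz
      have := hz.2
      rw [Set.uIcc_of_le (by simp; linarith)] at this
      have h2 : |z.im| ≤ π := abs_le.2 this
      show |z.im| < _
      linarith
  set M : ℝ := 4 * Real.exp L + 2 * ‖(Complex.exp L - 1) / L‖ with hM
  have hlim : Tendsto (fun R : ℝ => ∫ u in (-R)..R, (p u - q u)) atTop (𝓝 0) := by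
    have hb : ∀ᶠ R : ℝ in atTop, ‖∫ u in (-R)..R, (p u - q u)‖ ≤ 2 * M / R := by
      filter_upwards [eventually_ge_atTop 1, eventually_ge_atTop (L + 1),
        eventually_ge_atTop (2 * L)] with R h1 h2 h3
      have key : ∀ s : ℝ, (s = R ∨ s = -R) →
          ‖∫ y in (-π)..π, K ((s : ℝ) + y * Complex.I)‖ ≤ M / R * |π - -π| := by
        intro s hs
        refine intervalIntegral.norm_integral_le_of_norm_le_const fun y hy => ?_
        rw [Set.uIoc_of_le (by linarith)] at hy
        have hy' : |y| ≤ π := abs_le.2 ⟨hy.1.le, hy.2⟩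
        have hn1 : (s : ℂ) + y * Complex.I ≠ 0 := by
          intro h
          have := congrArg Complex.re h
          simp at this
          rcases hs with h | h <;> linarith
        have hn2 : (s : ℂ) + y * Complex.I ≠ L := by
          intro h
          have := congrArg Complex.re h
          simp at this
          rcases hs with h | h <;> linarith
        rw [hKe _ (hmem s y hy') hn1 hn2]
        exact side_bound L hL _ R h1 h2 h3 (by simpa using hs)
      have k1 := key R (Or.inl rfl)
      have k2 := key (-R) (Or.inr rfl)
      have hr := congrArg norm (hrect R)
      have hs : ‖Complex.I • (∫ y in (-π)..π, K ((-R : ℝ) + y * Complex.I)) -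
        Complex.I • (∫ y in (-π)..π, K ((R : ℝ) + y * Complex.I))‖ ≤ 
        M / R * |π - -π| + M / R * |π - -π| := by
        refine (norm_sub_le _ _).trans ?_
        rw [norm_smul, norm_smul, Complex.norm_I, one_mul, one_mul]
        exact add_le_add k2 k1
      rw [← hr, norm_mul, Complex.norm_real] at hs
      have h2pi : ‖(2 * π * Complex.I : ℂ)‖ = 2 * π := by
        simp [abs_of_pos hpi]
      have habs : |π - -π| = 2 * π := by rw [abs_of_pos (by linarith)]; ring
      rw [h2pi, habs] at hs
      have : 2 * π * ‖∫ u in (-R)..R, (p u - q u)‖ ≤ 2 * π * (2 * M / R) := by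
        calc _ ≤ _ := hs
          _ = _ := by ring
      exact le_of_mul_le_mul_left this (by positivity)
    exact squeeze_zero_norm' hb (tendsto_const_nhds.div_atTop tendsto_id)
  have hlim2 := intervalIntegral_tendsto_integral (hpi'.sub hqi) tendsto_neg_atTop_atBot
    (tendsto_id (α := ℝ))
  have := tendsto_nhds_unique hlim hlim2
  simp only [Pi.sub_apply] at this
  rw [integral_sub hpi' hqi, hpv] at this
  linarith

theorem stmt_15 (x : ℝ) (hx : 0 < x) :
    x / Real.log (1 + x) =
      ∫ t in Set.Ioi (1 : ℝ),
        t / ((t - 1) * ((Real.log (t - 1)) ^ 2 + Real.pi ^ 2)) * ((1 + x) / (x + t)) := by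
  have hL : 0 < Real.log (1 + x) := Real.log_pos (by linarith)
  have h := main_int _ hL
  rw [Real.exp_log (by linarith)] at h
  have himg : (fun u : ℝ => 1 + Real.exp u) '' Set.univ = Set.Ioi 1 := by
    ext t
    simp only [Set.image_univ, Set.mem_range, Set.mem_Ioi]
    constructor
    · rintro ⟨u, rfl⟩; linarith [Real.exp_pos u]
    · intro ht; exact ⟨Real.log (t - 1), by rw [Real.exp_log (by linarith)]; ring⟩
  rw [← himg, integral_image_eq_integral_abs_deriv_smul (f' := Real.exp) MeasurableSet.univ
    (fun u _ => ((Real.hasDerivAt_exp u).const_add 1).hasDerivWithinAt)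
    (fun a _ b _ hab => Real.exp_injective (by simpa using hab)), setIntegral_univ]
  have h0 : x / Real.log (1 + x) = (1 + x - 1) / Real.log (1 + x) := by ring
  rw [h0, ← h]
  congr 1
  funext u
  have := Real.exp_pos u
  rw [abs_of_pos this, add_sub_cancel_left, Real.log_exp, smul_eq_mul]
  have h3 : u ^ 2 + π ^ 2 ≠ 0 := by have := Real.pi_pos; positivity
  have h4 : 1 + x + Real.exp u ≠ 0 := by positivity
  have h5 : x + (1 + Real.exp u) ≠ 0 := by positivity
  field_simp
  ring
end

section
/- For every integer n ≥ 1, the n-th Bernoulli number of the second kind satisfies (-1)^{n+1} bₙ = ∫₀¹ s^{n-2}/((ln(1/s - 1))² + π²) ds, where the integral is over s ∈ (0,1). -/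
open MeasureTheory Real

/-- binomial coefficient polynomial -/
noncomputable def cc : ℕ → ℝ → ℝ
  | 0, _ => 1
  | (n+1), t => cc n t * (t - n) / (n + 1)

lemma cc_eq (n : ℕ) (t : ℝ) : Ring.choose t n = cc n t := by
  induction n with
  | zero => simp [cc]
  | succ n ih =>
    have h1 := Ring.choose_smul_choose t (Nat.le_succ n)
    simp at h1
    rw [cc, ← ih]
    have : (n:ℝ) + 1 ≠ 0 := by positivity
    field_simp
    linarith

lemma cc_cont (n : ℕ) : Continuous (cc n) := by
  induction n with
  | zero => exact continuous_const
  | succ n ih => 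
    change Continuous (fun t => cc n t * (t - n) / (n + 1))
    fun_prop

lemma cc_bound (n : ℕ) (t : ℝ) (h0 : 0 ≤ t) (h1 : t ≤ 1) : |cc n t| ≤ 1 := by
  induction n with
  | zero => simp [cc]
  | succ n ih =>
    rw [cc, mul_div_assoc, abs_mul]
    have : |(t - n) / (n + 1)| ≤ 1 := by
      rw [abs_div, abs_of_pos (show (0:ℝ) < n + 1 by positivity), div_le_one (by positivity), abs_le]
      have : (0:ℝ) ≤ n := by positivity
      constructor <;> linarith
    exact mul_le_one₀ ih (abs_nonneg _) this

lemma cc_hasSum (t x : ℝ) (hx : |x| < 1) : HasSum (fun n => cc n t * x ^ n) ((1 + x) ^ t) := by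
  have := (Real.one_add_rpow_hasFPowerSeriesOnBall_zero (a := t)).hasSum (y := x)
    (by simpa [enorm_eq_nnnorm, ← NNReal.coe_lt_coe] using hx)
  simpa [cc_eq, binomialSeries, FormalMultilinearSeries.coeff_ofScalars, mul_comm] using this

lemma int_rpow (x : ℝ) (hx : |x| < 1) :
    ∫ t in (0:ℝ)..1, (1 + x) ^ t = if x = 0 then 1 else x / Real.log (1 + x) := by
  have hp : 0 < 1 + x := by linarith [(abs_lt.1 hx).1]
  split_ifs with h
  · simp [h]
  · have hL : Real.log (1 + x) ≠ 0 := by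
      apply Real.log_ne_zero_of_pos_of_ne_one hp; simpa using h
    have : ∀ t ∈ Set.uIcc (0:ℝ) 1, HasDerivAt (fun t => (1+x)^t / Real.log (1+x)) ((1+x)^t) t := by
      intro t _
      have := (Real.hasStrictDerivAt_const_rpow hp t).hasDerivAt.div_const (Real.log (1+x))
      rwa [mul_div_cancel_right₀ _ hL] at this
    rw [intervalIntegral.integral_eq_sub_of_hasDerivAt this]
    · simp; ring
    · apply Continuous.intervalIntegrable
      exact Real.continuous_const_rpow hp.ne'

lemma b_eq (b : ℕ → ℝ)
    (hb : ∀ x : ℝ, |x| < 1 →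
      HasSum (fun n : ℕ => b n * x ^ n)
        (if x = 0 then 1 else x / Real.log (1 + x))) (n : ℕ) :
    b n = ∫ t in (0:ℝ)..1, cc n t := by
  have key : ∀ (c : ℕ → ℝ), (∀ x : ℝ, |x| < 1 →
      HasSum (fun n : ℕ => c n * x ^ n)
        (if x = 0 then 1 else x / Real.log (1 + x))) → 
      HasFPowerSeriesAt (fun x : ℝ => if x = 0 then 1 else x / Real.log (1 + x))
        (FormalMultilinearSeries.ofScalars ℝ c) 0 := by
    intro c hc
    rw [hasFPowerSeriesAt_iff]
    filter_upwards [Metric.ball_mem_nhds (0:ℝ) one_pos] with z hz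
    have := hc z (by simpa using hz)
    simpa [mul_comm, FormalMultilinearSeries.coeff_ofScalars] using this
  have h1 := key b hb
  have h2 := key (fun n => ∫ t in (0:ℝ)..1, cc n t) (by
    intro x hx
    rw [← int_rpow x hx]
    simp_rw [← intervalIntegral.integral_mul_const]
    apply intervalIntegral.hasSum_integral_of_dominated_convergence (fun n _ => |x| ^ n)
    · intro n; exact ((cc_cont n).mul_const _).aestronglyMeasurable
    · intro n
      refine Filter.Eventually.of_forall fun t ht => ?_
      rw [Set.uIoc_of_le zero_le_one] at ht
      rw [norm_mul, norm_pow, Real.norm_eq_abs, Real.norm_eq_abs]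
      exact mul_le_of_le_one_left (by positivity) (cc_bound n t ht.1.le ht.2)
    · exact Filter.Eventually.of_forall fun t ht => summable_geometric_of_lt_one (abs_nonneg _) hx
    · exact intervalIntegrable_const
    · exact Filter.Eventually.of_forall fun t ht => cc_hasSum t x hx)
  have h3 := h1.eq_formalMultilinearSeries h2
  rw [FormalMultilinearSeries.ofScalars_series_eq_iff] at h3
  exact congrFun h3 n

lemma beta_int {α β : ℝ} (hα : 0 < α) (hβ : 0 < β) :
    IntegrableOn (fun x : ℝ => x ^ (α - 1) * (1 - x) ^ (β - 1)) (Set.Ioo 0 1) ∧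
    ∫ x in Set.Ioo (0:ℝ) 1, x ^ (α - 1) * (1 - x) ^ (β - 1) = ProbabilityTheory.beta α β := by
  have hi := Complex.betaIntegral_convergent (u := α) (v := β) (by simpa) (by simpa)
  rw [intervalIntegrable_iff_integrableOn_Ioo_of_le zero_le_one] at hi
  have he : ∀ x ∈ Set.Ioo (0:ℝ) 1, ((x:ℂ) ^ ((α:ℂ) - 1) * (1 - (x:ℂ)) ^ ((β:ℂ) - 1))
      = ((x ^ (α - 1) * (1 - x) ^ (β - 1) : ℝ) : ℂ) := by
    intro x hx
    push_cast
    rw [Complex.ofReal_cpow hx.1.le, Complex.ofReal_cpow (by linarith [hx.2])]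
    push_cast; rfl
  have hi2 := (hi.congr_fun he measurableSet_Ioo)
  refine ⟨by simpa [IntegrableOn] using Integrable.re hi2, ?_⟩
  rw [ProbabilityTheory.beta_eq_betaIntegralReal α β hα hβ, Complex.betaIntegral,
    intervalIntegral.integral_of_le zero_le_one, integral_Ioc_eq_integral_Ioo,
    setIntegral_congr_fun measurableSet_Ioo he, integral_complex_ofReal, Complex.ofReal_re]

lemma cc_beta (n : ℕ) (t : ℝ) (h0 : 0 < t) (h1 : t < 1) :
    (-1 : ℝ) ^ (n + 2) * cc (n+1) t = 
      sin (π * t) / π * ProbabilityTheory.beta (n + 1 - t) (1 + t) := by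
  have hs : 0 < sin (π * t) := sin_pos_of_pos_of_lt_pi (by positivity) (by nlinarith [pi_pos])
  have hG : ∀ n : ℕ, Real.Gamma (n + 1 - t + (1 + t)) = (Nat.factorial (n+1) : ℝ) := by
    intro n
    rw [show (n:ℝ) + 1 - t + (1 + t) = ((n+1 : ℕ):ℝ) + 1 by push_cast; ring]
    exact Real.Gamma_nat_eq_factorial _
  induction n with
  | zero => 
    have := Real.Gamma_mul_Gamma_one_sub t
    have h2 := hG 0
    have h3 := Real.Gamma_add_one h0.ne'
    rw [ProbabilityTheory.beta, h2, add_comm 1 t, h3]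
    simp [cc]
    rw [show Real.Gamma (1 - t) * (t * Real.Gamma t) = t * (Real.Gamma t * Real.Gamma (1 - t)) by ring, this]
    generalize sin (π * t) = S at hs
    field_simp
  | succ n ih =>
    rw [ProbabilityTheory.beta, hG] at ih ⊢
    have hp : 0 < (n:ℝ) + 1 - t := by have : (0:ℝ) ≤ n := by positivity
                                      linarith
    have h3 := Real.Gamma_add_one hp.ne'
    rw [cc]
    push_cast
    rw [show (n:ℝ) + 1 + 1 - t = n + 1 - t + 1 by ring, h3, Nat.factorial_succ (n+1)]
    push_cast
    calc _ = (-1) ^ (n+2) * cc (n+1) t * ((n + 1 - t) / (n + 1 + 1)) := by ring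
      _ = _ := by rw [ih]; field_simp

lemma int_sin (L : ℝ) : ∫ t in (0:ℝ)..1, sin (π * t) * exp (t * L) =
    π * (exp L + 1) / (L ^ 2 + π ^ 2) := by
  have hne : L ^ 2 + π ^ 2 ≠ 0 := by positivity
  have : ∀ t ∈ Set.uIcc (0:ℝ) 1, HasDerivAt 
      (fun t => exp (t * L) * (L * sin (π * t) - π * cos (π * t)) / (L^2+π^2)) 
      (sin (π * t) * exp (t * L)) t := by
    intro t _
    have e := ((hasDerivAt_id t).mul_const L).exp
    have p := (hasDerivAt_id t).const_mul π
    have := (e.mul ((p.sin.const_mul L).sub (p.cos.const_mul π))).div_const (L^2+π^2)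
    refine this.congr_deriv ?_
    simp
    field_simp
    ring
  rw [intervalIntegral.integral_eq_sub_of_hasDerivAt this]
  · simp; ring
  · apply Continuous.intervalIntegrable; fun_prop

lemma inner_int (n : ℕ) (s : ℝ) (hs : s ∈ Set.Ioo (0:ℝ) 1) :
    ∫ t in Set.Ioo (0:ℝ) 1, sin (π * t) / π * (s ^ ((n:ℝ) + 1 - t - 1) * (1 - s) ^ (1 + t - 1)) =
      s ^ (((n + 1 : ℕ) : ℤ) - 2) / ((Real.log (1 / s - 1)) ^ 2 + Real.pi ^ 2) := by
  obtain ⟨h0, h1⟩ := hs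
  have h1' : 0 < 1 - s := by linarith
  have hq : 1 / s - 1 = (1 - s) / s := by field_simp
  have hq0 : 0 < (1 - s) / s := by positivity
  have he : ∀ t : ℝ, sin (π * t) / π * (s ^ ((n:ℝ) + 1 - t - 1) * (1 - s) ^ (1 + t - 1)) = 
     s ^ n / π * (sin (π * t) * exp (t * Real.log (1 / s - 1))) := by
    intro t
    rw [hq, mul_comm t, ← Real.rpow_def_of_pos hq0, Real.div_rpow h1'.le h0.le,
      show (n:ℝ) + 1 - t - 1 = n - t by ring, Real.rpow_sub h0, Real.rpow_natCast,
      show 1 + t - 1 = t by ring]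
    field_simp
  simp_rw [he]
  rw [integral_const_mul, ← integral_Ioc_eq_integral_Ioo, ← intervalIntegral.integral_of_le zero_le_one,
    int_sin, hq, Real.exp_log hq0, show (((n + 1 : ℕ) : ℤ) - 2) = (n:ℤ) - 1 by push_cast; ring,
    zpow_sub_one₀ h0.ne', zpow_natCast]
  field_simp
  ring

/-- For every `n ≥ 1`, the `n`-th Bernoulli number of the second kind (the `n`-th Taylor
coefficient at `0` of `x ↦ x/ln(1+x)`, extended by the value `1` at `x = 0`) satisfies
`(-1)^{n+1} bₙ = ∫₀¹ s^{n-2}/((ln(1/s - 1))² + π²) ds`. -/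
theorem stmt_16 (b : ℕ → ℝ)
    (hb : ∀ x : ℝ, |x| < 1 →
      HasSum (fun n : ℕ => b n * x ^ n)
        (if x = 0 then 1 else x / Real.log (1 + x))) :
    ∀ n : ℕ, 1 ≤ n →
      (-1 : ℝ) ^ (n + 1) * b n =
        ∫ s in Set.Ioo (0 : ℝ) 1,
          s ^ ((n : ℤ) - 2) / ((Real.log (1 / s - 1)) ^ 2 + Real.pi ^ 2) := by
  intro m hm
  obtain ⟨n, rfl⟩ : ∃ n, m = n + 1 := ⟨m - 1, by omega⟩
  rw [b_eq b hb, ← setIntegral_congr_fun measurableSet_Ioo (fun s hs => inner_int n s hs)]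
  have hpos : ∀ t ∈ Set.Ioo (0:ℝ) 1, 0 < (n:ℝ) + 1 - t ∧ 0 < 1 + t := by
    intro t ht
    have : (0:ℝ) ≤ n := by positivity
    constructor <;> linarith [ht.1, ht.2]
  have hin : ∀ t ∈ Set.Ioo (0:ℝ) 1, ∫ s in Set.Ioo (0:ℝ) 1, 
      sin (π * t) / π * (s ^ ((n:ℝ) + 1 - t - 1) * (1 - s) ^ (1 + t - 1)) =
      (-1 : ℝ) ^ (n + 2) * cc (n+1) t := by
    intro t ht
    rw [integral_const_mul, (beta_int (hpos t ht).1 (hpos t ht).2).2, cc_beta n t ht.1 ht.2]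
  rw [intervalIntegral.integral_of_le zero_le_one, integral_Ioc_eq_integral_Ioo, ← integral_const_mul,
    ← setIntegral_congr_fun measurableSet_Ioo hin]
  apply integral_integral_swap
  rw [integrable_prod_iff]
  · constructor
    · refine (ae_restrict_iff' measurableSet_Ioo).2 (Filter.Eventually.of_forall fun t ht => ?_)
      exact (beta_int (hpos t ht).1 (hpos t ht).2).1.const_mul (sin (π * t) / π)
    · have : IntegrableOn (fun t => (-1 : ℝ) ^ (n + 2) * cc (n+1) t) (Set.Ioo 0 1) :=
        (((cc_cont (n+1)).const_mul _).integrableOn_Icc (a := 0) (b := 1)).mono_set Set.Ioo_subset_Icc_self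
      refine this.congr_fun (fun t ht => ?_) measurableSet_Ioo
      simp only
      rw [← hin t ht]
      refine setIntegral_congr_fun measurableSet_Ioo fun s hs => ?_
      have hs' : 0 < sin (π * t) := sin_pos_of_pos_of_lt_pi (mul_pos pi_pos ht.1) (by nlinarith [pi_pos, ht.2])
      have h1 : 0 < 1 - s := by linarith [hs.2]
      have h0 := hs.1
      simp only [Function.uncurry]
      rw [Real.norm_of_nonneg]
      positivity
  · apply Measurable.aestronglyMeasurable
    simp only [Function.uncurry_def]
    fun_prop
end
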